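/- arXiv:2410.22297 — 2 statements merged into one kernel-verified Lean document; each statement's English description precedes it below -/
import Mathlib

section
/- (Single-epoch full-shuffling variant of Algorithm 2.) Under the NC assumptions, the component-variance bounds, the two gradient-mapping domination assumptions (for w with (Λ₀,Λ₁) and for u with (Λ̂₀,Λ̂₁)), the L_f-smoothness-type condition on f, and Ψ₀* > −∞, set μ_ψ := μ_h + μ_H, κ := L_u/μ_ψ, C_w := 5L_w²[Λ₁(3Θ_w+1) + 3σ_w²], C_u := (L_u²/2)[Λ̂₁(3Θ_u+2) + 3σ_u²]. Run Algorithm 2 where each outer epoch performs exactly one epoch of the shuffling gradient-ascent routine with learning rate η̂ := 15κ²η followed by one shuffling descent epoch with learning rate η, where 0 < η ≤ min{1/(60κ²L_u), 1/√(10Λ₀L_w²(3Θ_w+1)), 2√L_u/(κ√(15(4L_u²+μ_ψ²))), √L_u/(15κ√(2L_u³Λ̂₀(3Θ_u+2)+μ_ψ²)), 1/(4L_{Φ₀}+L_w+L_f)}. Then for every T: (1/(T+1)) ∑_{t=0}^T ‖G_η(w̃_t)‖² ≤ [24(Ψ₀(w̃₀) − Ψ₀*) + 8(Ψ₀(w̃₀)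 − L(w̃₀,ũ₀))]/(η(T+1)) + 8C_wη² + 8C_uη̂³/η. -/
open RealInnerProductSpace Finset

/-- Subgradient of a convex function: `g ∈ ∂f(x)`. -/
def SubgradAt {E : Type*} [NormedAddCommGroup E] [InnerProductSpace ℝ E]
    (f : E → ℝ) (g x : E) : Prop :=
  ∀ y, f x + ⟪g, y - x⟫ ≤ f y

set_option linter.unusedSectionVars false

section helpers
variable {E : Type*} [NormedAddCommGroup E] [InnerProductSpace ℝ E]

/-- A first-order minorant with quadratic error upgrades to a strong subgradient inequality. -/
lemma aux_strong_subgrad {h : E → ℝ} {μ C : ℝ} {p g : E}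
    (hs : StrongConvexOn Set.univ μ h)
    (hC : ∀ y, h p + ⟪g, y - p⟫ - C * ‖y - p‖ ^ 2 ≤ h y) (y : E) :
    h p + ⟪g, y - p⟫ + μ / 2 * ‖y - p‖ ^ 2 ≤ h y := by
  have key : ∀ t : ℝ, 0 < t → t ≤ 1 →
      h p + ⟪g, y - p⟫ + μ / 2 * ‖y - p‖ ^ 2 ≤ h y + t * ((C + μ / 2) * ‖y - p‖ ^ 2) := by
    intro t ht ht1
    have h1 := hC (p + t • (y - p))
    have h2 := hs.2 (Set.mem_univ p) (Set.mem_univ y) (sub_nonneg.2 ht1) ht.le (by ring)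
    have e1 : (1 - t) • p + t • y = p + t • (y - p) := by module
    have e2 : p + t • (y - p) - p = t • (y - p) := by module
    rw [e1] at h2
    rw [e2, inner_smul_right, norm_smul, mul_pow, Real.norm_eq_abs, sq_abs] at h1
    rw [norm_sub_rev p y] at h2
    simp only [smul_eq_mul] at h2
    have h3 : t * (h p + ⟪g, y - p⟫ + μ / 2 * ‖y - p‖ ^ 2) ≤
        t * (h y + t * ((C + μ / 2) * ‖y - p‖ ^ 2)) := by nlinarith
    exact le_of_mul_le_mul_left h3 ht
  have hlim : Filter.Tendsto (fun t : ℝ => h y + t * ((C + μ / 2) * ‖y - p‖ ^ 2))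
      (nhdsWithin 0 (Set.Ioi 0)) (nhds (h y + 0 * ((C + μ / 2) * ‖y - p‖ ^ 2))) := by
    apply tendsto_nhdsWithin_of_tendsto_nhds
    exact (Continuous.tendsto (by fun_prop) 0)
  rw [zero_mul, add_zero] at hlim
  refine ge_of_tendsto hlim ?_
  filter_upwards [Ioc_mem_nhdsGT (zero_lt_one' ℝ)] with t ht
  exact key t ht.1 ht.2

variable [CompleteSpace E]

lemma aux_line {φ : E → ℝ} {g : E → E} (hg : ∀ x, HasGradientAt φ (g x) x) (x v : E) (t : ℝ) :
    HasDerivAt (fun t : ℝ => φ (x + t • v)) ⟪g (x + t • v), v⟫ t := by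
  have h1 : HasDerivAt (fun t : ℝ => x + t • v) v t := by
    simpa using ((hasDerivAt_id t).smul_const v).const_add x
  have h2 := (hg (x + t • v)).hasFDerivAt.comp_hasDerivAt t h1
  simp at h2
  exact h2

lemma aux_descent {φ : E → ℝ} {g : E → E} {L : ℝ} (hg : ∀ x, HasGradientAt φ (g x) x)
    (hL : ∀ x y, ‖g x - g y‖ ≤ L * ‖x - y‖) (x y : E) :
    φ y ≤ φ x + ⟪g x, y - x⟫ + L / 2 * ‖y - x‖ ^ 2 := by
  set v := y - x with hv
  let r : ℝ → ℝ := fun t => φ (x + t • v) - (t * ⟪g x, v⟫ + L / 2 * ‖v‖ ^ 2 * t ^ 2)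
  have hr : ∀ t, HasDerivAt r (⟪g (x + t • v), v⟫ - (⟪g x, v⟫ + L / 2 * ‖v‖ ^ 2 * (2 * t))) t := by
    intro t
    have h1 := aux_line hg x v t
    have h2 : HasDerivAt (fun t : ℝ => t * ⟪g x, v⟫ + L / 2 * ‖v‖ ^ 2 * t ^ 2)
        (⟪g x, v⟫ + L / 2 * ‖v‖ ^ 2 * (2 * t)) t := by
      have h3 := ((hasDerivAt_id t).mul_const ⟪g x, v⟫).add
        ((hasDerivAt_pow 2 t).const_mul (L / 2 * ‖v‖ ^ 2))
      simp at h3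
      exact h3
    exact h1.sub h2
  have hanti : AntitoneOn r (Set.Icc 0 1) := by
    apply antitoneOn_of_deriv_nonpos (convex_Icc 0 1)
    · exact fun t _ => (hr t).continuousAt.continuousWithinAt
    · exact fun t _ => (hr t).differentiableAt.differentiableWithinAt
    · intro t ht
      rw [interior_Icc] at ht
      rw [(hr t).deriv]
      have h1 : ⟪g (x + t • v) - g x, v⟫ ≤ ‖g (x + t • v) - g x‖ * ‖v‖ := real_inner_le_norm _ _
      have h2 := hL (x + t • v) x
      rw [add_sub_cancel_left, norm_smul, Real.norm_eq_abs, abs_of_pos ht.1] at h2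
      rw [inner_sub_left] at h1
      nlinarith [mul_le_mul_of_nonneg_right h2 (norm_nonneg v)]
  have := hanti (Set.left_mem_Icc.2 zero_le_one) (Set.right_mem_Icc.2 zero_le_one) zero_le_one
  simp only [r] at this
  simp only [one_smul, zero_smul, add_zero, hv, add_sub_cancel] at this
  simp only [hv]
  linarith

/-- Function with gradient bounded by `C` is `C`-Lipschitz. -/
lemma aux_mvt {φ : E → ℝ} {g : E → E} {C : ℝ} (hg : ∀ x, HasGradientAt φ (g x) x)
    (hC : ∀ x, ‖g x‖ ≤ C) (x y : E) : φ y - φ x ≤ C * ‖y - x‖ := by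
  have := Convex.norm_image_sub_le_of_norm_hasFDerivWithin_le (𝕜 := ℝ) (f := φ) (s := Set.univ)
    (f' := fun x => (InnerProductSpace.toDual ℝ E) (g x)) (C := C) (x := x) (y := y)
    (fun x _ => (hg x).hasFDerivAt.hasFDerivWithinAt) (fun x _ => by simpa using hC x)
    convex_univ (Set.mem_univ _) (Set.mem_univ _)
  exact (le_abs_self _).trans this

/-- Contraction of a gradient ascent step on a smooth strongly concave function. -/
lemma aux_step {φ : E → ℝ} {g : E → E} {L μ γ : ℝ} (hL0 : 0 < L) (hγ : 0 ≤ γ)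
    (hγL : γ * L ≤ 1 / 4) (hμ : 0 ≤ μ)
    (hg : ∀ x, HasGradientAt φ (g x) x)
    (hL : ∀ x y, ‖g x - g y‖ ≤ L * ‖x - y‖)
    (hsc : StrongConcaveOn Set.univ μ φ) (x y : E) :
    μ * ‖x - y‖ ^ 2 ≤ L * ‖x - y‖ ^ 2 ∧
    ‖(x + γ • g x) - (y + γ • g y)‖ ^ 2 ≤ (1 - 7 / 4 * (γ * μ)) * ‖x - y‖ ^ 2 := by
  have hneg : StrongConvexOn Set.univ μ (-φ) := by
    refine ⟨convex_univ, fun a _ b _ s t hs ht hst => ?_⟩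
    have := hsc.2 (Set.mem_univ a) (Set.mem_univ b) hs ht hst
    simp only [Pi.neg_apply, smul_eq_mul] at this ⊢
    linarith
  have hgn : ∀ x, HasGradientAt (-φ) (-g x) x := by
    intro x
    have := (hg x).hasFDerivAt.neg
    rw [hasGradientAt_iff_hasFDerivAt, map_neg]
    exact this
  have hLn : ∀ x y, ‖-g x - -g y‖ ≤ L * ‖x - y‖ := by
    intro x y
    have := hL x y
    rwa [neg_sub_neg, norm_sub_rev]
  have hconc : ∀ x y, φ y ≤ φ x + ⟪g x, y - x⟫ - μ / 2 * ‖y - x‖ ^ 2 := by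
    intro x y
    have h1 := aux_strong_subgrad (h := -φ) (p := x) (g := -g x) (C := L / 2) hneg (by
      intro z
      have := aux_descent hg hL x z
      simp only [Pi.neg_apply, inner_neg_left]
      linarith) y
    simp only [Pi.neg_apply, inner_neg_left] at h1
    linarith
  -- cocoercivity
  have hco : ∀ x y, φ y ≤ φ x + ⟪g x, y - x⟫ - (2 * L)⁻¹ * ‖g x - g y‖ ^ 2 := by
    intro x y
    set z := y + L⁻¹ • (g y - g x) with hz
    have h1 := hconc x z
    have h2 := aux_descent hgn hLn y z
    have e1 : z - y = L⁻¹ • (g y - g x) := by rw [hz]; module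
    have e2 : z - x = (y - x) + L⁻¹ • (g y - g x) := by rw [hz]; module
    have h3 : 0 ≤ μ / 2 * ‖z - x‖ ^ 2 := by positivity
    rw [e2, inner_add_right] at h1
    rw [e2] at h3
    rw [e1] at h2
    simp only [Pi.neg_apply, inner_neg_left, inner_smul_right, norm_smul, mul_pow, norm_inv,
      Real.norm_eq_abs, abs_of_pos hL0] at h1 h2
    have h4 : ⟪g y, g y - g x⟫ - ⟪g x, g y - g x⟫ = ‖g x - g y‖ ^ 2 := by
      rw [← inner_sub_left, real_inner_self_eq_norm_sq, norm_sub_rev]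
    rw [norm_sub_rev (g y)] at h2
    have h5 : L / 2 * (L⁻¹ ^ 2 * ‖g x - g y‖ ^ 2) = (2 * L)⁻¹ * ‖g x - g y‖ ^ 2 := by
      field_simp
    have h6 : L⁻¹ * ⟪g y, g y - g x⟫ - L⁻¹ * ⟪g x, g y - g x⟫ =
        2 * ((2 * L)⁻¹ * ‖g x - g y‖ ^ 2) := by
      rw [← mul_sub, h4]; field_simp
    linarith
  have c1 := hco x y
  have c2 := hco y x
  have m1 := hconc x y
  have m2 := hconc y x
  have i1 : ⟪g x, y - x⟫ = -⟪g x, x - y⟫ := by rw [← inner_neg_right, neg_sub]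
  rw [i1] at c1 m1
  rw [norm_sub_rev (g y)] at c2
  rw [norm_sub_rev y] at m1
  have hin : ⟪g x - g y, x - y⟫ = ⟪g x, x - y⟫ - ⟪g y, x - y⟫ := inner_sub_left _ _ _
  set I := ⟪g x - g y, x - y⟫ with hI
  have hmI : I ≤ -(μ * ‖x - y‖ ^ 2) := by linarith
  have hcI : ‖g x - g y‖ ^ 2 ≤ L * (-I) := by
    have : L⁻¹ * ‖g x - g y‖ ^ 2 ≤ -I := by
      have : L⁻¹ = (2 * L)⁻¹ + (2 * L)⁻¹ := by field_simp; norm_num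
      rw [this]; linarith
    rwa [inv_mul_le_iff₀ hL0] at this
  constructor
  · have h1 : -I ≤ ‖g x - g y‖ * ‖x - y‖ := by
      have := abs_real_inner_le_norm (g x - g y) (x - y)
      exact (neg_le_abs _).trans this
    have h2 := mul_le_mul_of_nonneg_right (hL x y) (norm_nonneg (x - y))
    nlinarith
  · have e : (x + γ • g x) - (y + γ • g y) = (x - y) + γ • (g x - g y) := by module
    rw [e, norm_add_sq_real, inner_smul_right, norm_smul, mul_pow, Real.norm_eq_abs, sq_abs,
      real_inner_comm, ← hI]
    have hI0 : 0 ≤ -I := by nlinarith [mul_nonneg hμ (sq_nonneg ‖x - y‖)]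
    have s1 : γ ^ 2 * ‖g x - g y‖ ^ 2 ≤ γ * (1 / 4) * (-I) := by
      calc γ ^ 2 * ‖g x - g y‖ ^ 2 ≤ γ ^ 2 * (L * (-I)) := by gcongr
        _ = γ * (γ * L) * (-I) := by ring
        _ ≤ _ := by gcongr
    have s2 := mul_le_mul_of_nonneg_left hmI hγ
    nlinarith

end helpers

section shuffle
variable {E : Type*} [NormedAddCommGroup E] [InnerProductSpace ℝ E]

lemma aux_sum_id (n : ℕ) : ∑ i ∈ range n, (i : ℝ) ≤ (n : ℝ) ^ 2 / 2 := by
  induction n with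
  | zero => simp
  | succ k ih => rw [sum_range_succ]; push_cast; nlinarith

lemma aux_sum_sq (n : ℕ) : ∑ i ∈ range n, (i : ℝ) ^ 2 ≤ (n : ℝ) ^ 3 / 3 := by
  induction n with
  | zero => simp
  | succ k ih =>
    rw [sum_range_succ]; push_cast
    have : (0 : ℝ) ≤ k := Nat.cast_nonneg k
    nlinarith

lemma aux_norm_sum_sq (c : ℕ → E) {i n : ℕ} (hi : i ≤ n) :
    ‖∑ j ∈ range i, c j‖ ^ 2 ≤ i * ∑ j ∈ range n, ‖c j‖ ^ 2 := by
  have h1 : ‖∑ j ∈ range i, c j‖ ^ 2 ≤ (∑ j ∈ range i, ‖c j‖) ^ 2 := by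
    gcongr; exact norm_sum_le _ _
  have h2 := sq_sum_le_card_mul_sum_sq (s := range i) (f := fun j => ‖c j‖)
  rw [card_range] at h2
  have h3 : ∑ j ∈ range i, ‖c j‖ ^ 2 ≤ ∑ j ∈ range n, ‖c j‖ ^ 2 :=
    sum_le_sum_of_subset_of_nonneg (range_mono hi) (fun _ _ _ => sq_nonneg _)
  exact h1.trans (h2.trans (by gcongr))

lemma aux_sq3 (a b c : E) : ‖a + b + c‖ ^ 2 ≤ 3 * (‖a‖ ^ 2 + ‖b‖ ^ 2 + ‖c‖ ^ 2) := by
  have h1 : ‖a + b + c‖ ≤ ‖a‖ + ‖b‖ + ‖c‖ := norm_add₃_le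
  have h2 : ‖a + b + c‖ ^ 2 ≤ (‖a‖ + ‖b‖ + ‖c‖) ^ 2 := by gcongr
  nlinarith [sq_nonneg (‖a‖ - ‖b‖), sq_nonneg (‖a‖ - ‖c‖), sq_nonneg (‖b‖ - ‖c‖)]

lemma aux_sq2 (a b : E) : ‖a + b‖ ^ 2 ≤ 2 * (‖a‖ ^ 2 + ‖b‖ ^ 2) := by
  have h1 : ‖a + b‖ ≤ ‖a‖ + ‖b‖ := norm_add_le _ _
  have h2 : ‖a + b‖ ^ 2 ≤ (‖a‖ + ‖b‖) ^ 2 := by gcongr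
  nlinarith [sq_nonneg (‖a‖ - ‖b‖)]

lemma aux_shuffle_w (n : ℕ) (hn : 0 < n) (G : ℕ → E → E) (L η V : ℝ)
    (hL : ∀ j x y, ‖G j x - G j y‖ ^ 2 ≤ L ^ 2 * ‖x - y‖ ^ 2) (W : ℕ → E)
    (hW : ∀ i, i < n → W (i + 1) = W i - (η / n) • G i (W i)) (c : E)
    (hc : c = (n : ℝ)⁻¹ • ∑ j ∈ range n, G j (W 0))
    (hV : (n : ℝ)⁻¹ * ∑ j ∈ range n, ‖G j (W 0) - c‖ ^ 2 ≤ V)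
    (hη : L ^ 2 * η ^ 2 ≤ 1 / 10) :
    ∃ g, W n = W 0 - η • g ∧ 17 / 20 * ‖g - c‖ ^ 2 ≤ L ^ 2 * η ^ 2 * (3 / 2 * V + ‖c‖ ^ 2) := by
  have hn' : (0 : ℝ) < n := by exact_mod_cast hn
  have hV' : ∑ j ∈ range n, ‖G j (W 0) - c‖ ^ 2 ≤ n * V := by rwa [inv_mul_le_iff₀ hn'] at hV
  have hsum : ∀ i, i ≤ n → W i - W 0 = -((η / n) • ∑ j ∈ range i, G j (W j)) := by
    intro i
    induction i with
    | zero => simp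
    | succ k ih =>
      intro hk
      rw [hW k (by omega), sum_range_succ, smul_add, neg_add, ← ih (by omega)]
      abel
  set P := ∑ j ∈ range n, ‖W j - W 0‖ ^ 2 with hP
  have hP0 : 0 ≤ P := sum_nonneg fun _ _ => sq_nonneg _
  have hA : ∑ j ∈ range n, ‖G j (W j) - G j (W 0)‖ ^ 2 ≤ L ^ 2 * P := by
    rw [hP, mul_sum]
    exact sum_le_sum fun j _ => hL j _ _
  have hb : ∀ i ∈ range n, ‖W i - W 0‖ ^ 2 ≤
      3 * (η / n) ^ 2 * (i * (L ^ 2 * P + n * V) + i ^ 2 * ‖c‖ ^ 2) := by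
    intro i hi
    have hi' : i ≤ n := (mem_range.1 hi).le
    have e : ∑ j ∈ range i, G j (W j) = ∑ j ∈ range i, (G j (W j) - G j (W 0)) +
        ∑ j ∈ range i, (G j (W 0) - c) + (i : ℝ) • c := by
      rw [← sum_add_distrib]
      simp only [sub_add_sub_cancel, sum_sub_distrib, sum_const, card_range]
      rw [Nat.cast_smul_eq_nsmul]; abel
    rw [hsum i hi', norm_neg, norm_smul, mul_pow, Real.norm_eq_abs, sq_abs, e]
    have h1 := aux_sq3 (∑ j ∈ range i, (G j (W j) - G j (W 0)))
      (∑ j ∈ range i, (G j (W 0) - c)) ((i : ℝ) • c)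
    have h2 := (aux_norm_sum_sq (fun j => G j (W j) - G j (W 0)) hi').trans
      (mul_le_mul_of_nonneg_left hA (Nat.cast_nonneg i))
    have h3 := (aux_norm_sum_sq (fun j => G j (W 0) - c) hi').trans
      (mul_le_mul_of_nonneg_left hV' (Nat.cast_nonneg i))
    have h4 : ‖(i : ℝ) • c‖ ^ 2 = i ^ 2 * ‖c‖ ^ 2 := by
      rw [norm_smul, mul_pow, Real.norm_eq_abs, sq_abs]
    rw [h4] at h1
    have h5 := h1.trans (by linarith : _ ≤ 3 * (i * (L ^ 2 * P + n * V) + i ^ 2 * ‖c‖ ^ 2))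
    calc _ ≤ (η / n) ^ 2 * (3 * (i * (L ^ 2 * P + n * V) + i ^ 2 * ‖c‖ ^ 2)) := by gcongr
      _ = _ := by ring
  have hV0 : 0 ≤ n * V := le_trans (sum_nonneg fun _ _ => sq_nonneg _) hV'
  have hPb : P ≤ η ^ 2 * (3 / 2 * L ^ 2 * P + 3 / 2 * (n * V) + n * ‖c‖ ^ 2) := by
    have h1 := sum_le_sum hb
    rw [← mul_sum, sum_add_distrib, ← sum_mul, ← sum_mul, ← hP] at h1
    have h2 : P ≤ 3 * (η / n) ^ 2 * ((n : ℝ) ^ 2 / 2 * (L ^ 2 * P + n * V) +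
        (n : ℝ) ^ 3 / 3 * ‖c‖ ^ 2) := by
      refine h1.trans ?_
      have := aux_sum_id n
      have := aux_sum_sq n
      gcongr
    refine h2.trans (le_of_eq ?_)
    field_simp
  refine ⟨(n : ℝ)⁻¹ • ∑ j ∈ range n, G j (W j), ?_, ?_⟩
  · have := hsum n le_rfl
    rw [smul_smul, ← div_eq_mul_inv, sub_eq_add_neg, ← this]; abel
  · have e : (n : ℝ)⁻¹ • ∑ j ∈ range n, G j (W j) - c =
        (n : ℝ)⁻¹ • ∑ j ∈ range n, (G j (W j) - G j (W 0)) := by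
      rw [hc, sum_sub_distrib, smul_sub]
    rw [e, norm_smul, mul_pow, Real.norm_eq_abs, sq_abs]
    have h2 := (aux_norm_sum_sq (fun j => G j (W j) - G j (W 0)) (le_refl n)).trans
      (mul_le_mul_of_nonneg_left hA (Nat.cast_nonneg n))
    have h3 : (n : ℝ)⁻¹ ^ 2 * ‖∑ j ∈ range n, (G j (W j) - G j (W 0))‖ ^ 2 ≤ L ^ 2 * P / n := by
      calc _ ≤ (n : ℝ)⁻¹ ^ 2 * (n * (L ^ 2 * P)) := by gcongr
        _ = _ := by field_simp
    have h4 : 17 / 20 * P ≤ η ^ 2 * (3 / 2 * (n * V) + n * ‖c‖ ^ 2) := by nlinarith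
    calc _ ≤ 17 / 20 * (L ^ 2 * P / n) := by gcongr
      _ = L ^ 2 / n * (17 / 20 * P) := by ring
      _ ≤ L ^ 2 / n * (η ^ 2 * (3 / 2 * (n * V) + n * ‖c‖ ^ 2)) := by gcongr
      _ = _ := by field_simp

lemma aux_shuffle_u (n : ℕ) (hn : 0 < n) (G : ℕ → E → E) (L η V q : ℝ) (hL0 : 0 ≤ L)
    (hη : 0 ≤ η) (hq0 : 0 ≤ q) (hq1 : q ≤ 1)
    (hL : ∀ j x y, ‖G j x - G j y‖ ≤ L * ‖x - y‖)
    (hq : ∀ j x y, ‖(x + (η / n) • G j x) - (y + (η / n) • G j y)‖ ≤ q * ‖x - y‖) (U : ℕ → E)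
    (hU : ∀ i, i < n → U (i + 1) = U i + (η / n) • G i (U i)) (s c : E)
    (hc : c = (n : ℝ)⁻¹ • ∑ j ∈ range n, G j s)
    (hV : (n : ℝ)⁻¹ * ∑ j ∈ range n, ‖G j s - c‖ ^ 2 ≤ V) :
    ∃ e, 0 ≤ e ∧ ‖U n - (s + η • c)‖ ≤ q ^ n * ‖U 0 - s‖ + e ∧
      e ^ 2 ≤ η ^ 4 * L ^ 2 * (2 / 3 * ‖c‖ ^ 2 + V) := by
  have hn' : (0 : ℝ) < n := by exact_mod_cast hn
  have hV' : ∑ j ∈ range n, ‖G j s - c‖ ^ 2 ≤ n * V := by rwa [inv_mul_le_iff₀ hn'] at hV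
  have hV0 : 0 ≤ n * V := le_trans (sum_nonneg fun _ _ => sq_nonneg _) hV'
  let v : ℕ → E := fun i => s + (η / n) • ∑ j ∈ range i, G j s
  have hv : ∀ i, v (i + 1) = v i + (η / n) • G i s := by
    intro i; simp only [v, sum_range_succ, smul_add, add_assoc]
  have hvs : ∀ i, v i - s = (η / n) • ∑ j ∈ range i, G j s := by
    intro i; simp [v]
  have hind : ∀ i, i ≤ n → ‖U i - v i‖ ≤ q ^ i * ‖U 0 - s‖ +
      (η / n) * L * ∑ j ∈ range i, ‖v j - s‖ := by
    intro i
    induction i with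
    | zero => simp [v]
    | succ k ih =>
      intro hk
      have ih' := ih (by omega)
      have e : U (k + 1) - v (k + 1) = ((U k + (η / n) • G k (U k)) -
          (v k + (η / n) • G k (v k))) + (η / n) • (G k (v k) - G k s) := by
        rw [hU k (by omega), hv]; module
      rw [e]
      refine (norm_add_le _ _).trans ?_
      have h1 := hq k (U k) (v k)
      have h2 : ‖(η / n) • (G k (v k) - G k s)‖ ≤ (η / n) * (L * ‖v k - s‖) := by
        rw [norm_smul, Real.norm_eq_abs, abs_of_nonneg (by positivity)]
        gcongr
        exact hL k _ _
      have h3 : q * ‖U k - v k‖ ≤ q * (q ^ k * ‖U 0 - s‖) +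
          (η / n) * L * ∑ j ∈ range k, ‖v j - s‖ := by
        have hS : 0 ≤ (η / n) * L * ∑ j ∈ range k, ‖v j - s‖ := by positivity
        nlinarith [mul_le_mul_of_nonneg_left ih' hq0]
      rw [sum_range_succ, pow_succ]
      nlinarith
  have hb : ∀ i ∈ range n, ‖v i - s‖ ^ 2 ≤
      2 * (η / n) ^ 2 * (i * (n * V) + i ^ 2 * ‖c‖ ^ 2) := by
    intro i hi
    have hi' : i ≤ n := (mem_range.1 hi).le
    have e : ∑ j ∈ range i, G j s = ∑ j ∈ range i, (G j s - c) + (i : ℝ) • c := by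
      simp only [sum_sub_distrib, sum_const, card_range]
      rw [Nat.cast_smul_eq_nsmul]; abel
    rw [hvs i, norm_smul, mul_pow, Real.norm_eq_abs, sq_abs, e]
    have h1 := aux_sq2 (∑ j ∈ range i, (G j s - c)) ((i : ℝ) • c)
    have h3 := (aux_norm_sum_sq (fun j => G j s - c) hi').trans
      (mul_le_mul_of_nonneg_left hV' (Nat.cast_nonneg i))
    have h4 : ‖(i : ℝ) • c‖ ^ 2 = i ^ 2 * ‖c‖ ^ 2 := by
      rw [norm_smul, mul_pow, Real.norm_eq_abs, sq_abs]
    rw [h4] at h1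
    have h5 := h1.trans (by linarith : _ ≤ 2 * (i * (n * V) + i ^ 2 * ‖c‖ ^ 2))
    calc _ ≤ (η / n) ^ 2 * (2 * (i * (n * V) + i ^ 2 * ‖c‖ ^ 2)) := by gcongr
      _ = _ := by ring
  have hPb : ∑ i ∈ range n, ‖v i - s‖ ^ 2 ≤ η ^ 2 * (n * V + 2 / 3 * n * ‖c‖ ^ 2) := by
    have h1 := sum_le_sum hb
    rw [← mul_sum, sum_add_distrib, ← sum_mul, ← sum_mul] at h1
    have h2 : ∑ i ∈ range n, ‖v i - s‖ ^ 2 ≤ 2 * (η / n) ^ 2 * ((n : ℝ) ^ 2 / 2 * (n * V) +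
        (n : ℝ) ^ 3 / 3 * ‖c‖ ^ 2) := by
      refine h1.trans ?_
      have := aux_sum_id n
      have := aux_sum_sq n
      gcongr
    refine h2.trans (le_of_eq ?_)
    field_simp
  refine ⟨(η / n) * L * ∑ j ∈ range n, ‖v j - s‖, by positivity, ?_, ?_⟩
  · have e : s + η • c = v n := by
      simp only [v, hc, smul_smul, div_eq_mul_inv]
    rw [e]; exact hind n le_rfl
  · have h2 := sq_sum_le_card_mul_sum_sq (s := range n) (f := fun j => ‖v j - s‖)
    rw [card_range] at h2
    have h3 := h2.trans (mul_le_mul_of_nonneg_left hPb hn'.le)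
    rw [mul_pow]
    calc _ ≤ (η / n * L) ^ 2 * (n * (η ^ 2 * (n * V + 2 / 3 * n * ‖c‖ ^ 2))) := by gcongr
      _ = _ := by field_simp; ring

/-- Sum over `Fin n` through the modular extension. -/
lemma aux_sum_mod {A : Type*} [AddCommMonoid A] (n : ℕ) (hn : 0 < n) (σ : Equiv.Perm (Fin n))
    (a : Fin n → A) :
    ∑ j ∈ range n, a (σ ⟨j % n, Nat.mod_lt j hn⟩) = ∑ i, a i := by
  rw [sum_range, ← Equiv.sum_comp σ a]
  refine sum_congr rfl fun i _ => ?_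
  congr 2
  exact Fin.ext (Nat.mod_eq_of_lt i.2)

end shuffle

section prox
variable {E : Type*} [NormedAddCommGroup E] [InnerProductSpace ℝ E]

lemma aux_prox {h : E → ℝ} {μ η : ℝ} {x p : E} (hs : StrongConvexOn Set.univ μ h)
    (hp : ∀ y, h p + (2 * η)⁻¹ * ‖p - x‖ ^ 2 ≤ h y + (2 * η)⁻¹ * ‖y - x‖ ^ 2) (y : E) :
    h p + ⟪η⁻¹ • (x - p), y - p⟫ + μ / 2 * ‖y - p‖ ^ 2 ≤ h y := by
  refine aux_strong_subgrad (C := (2 * η)⁻¹) hs (fun y => ?_) y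
  have h1 := hp y
  have e : y - x = (y - p) - (x - p) := by abel
  rw [e, norm_sub_sq_real (y - p), norm_sub_rev p x] at h1
  rw [inner_smul_left, real_inner_comm]
  simp only [conj_trivial]
  have : η⁻¹ = 2 * (2 * η)⁻¹ := by rw [mul_inv]; ring
  rw [this]
  nlinarith

lemma aux_prox_contr {h : E → ℝ} {μ η : ℝ} {x p s c : E} (hη : 0 < η)
    (hs : StrongConvexOn Set.univ μ h)
    (hp : ∀ y, h p + (2 * η)⁻¹ * ‖p - x‖ ^ 2 ≤ h y + (2 * η)⁻¹ * ‖y - x‖ ^ 2)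
    (hc : ∀ y, h s + ⟪c, y - s⟫ + μ / 2 * ‖y - s‖ ^ 2 ≤ h y) :
    (1 + η * μ) * ‖p - s‖ ≤ ‖x - (s + η • c)‖ := by
  have h1 := aux_prox hs hp s
  have h2 := hc p
  have e1 : η⁻¹ • (x - p) = η⁻¹ • (x - (s + η • c)) - η⁻¹ • (p - s) + c := by
    have : c = η⁻¹ • (η • c) := by rw [smul_smul, inv_mul_cancel₀ hη.ne', one_smul]
    nth_rewrite 2 [this]
    module
  have e2 : s - p = -(p - s) := by abel
  rw [e1, e2, inner_neg_right, norm_neg, inner_add_left, inner_sub_left, inner_smul_left,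
    inner_smul_left, real_inner_self_eq_norm_sq] at h1
  simp only [conj_trivial] at h1
  have h3 : η⁻¹ * ‖p - s‖ ^ 2 + μ * ‖p - s‖ ^ 2 ≤ η⁻¹ * ⟪x - (s + η • c), p - s⟫ := by linarith
  have h4 : (1 + η * μ) * ‖p - s‖ ^ 2 ≤ ⟪x - (s + η • c), p - s⟫ := by
    have := mul_le_mul_of_nonneg_left h3 hη.le
    have e3 : η * η⁻¹ = 1 := mul_inv_cancel₀ hη.ne'
    have e4 : η * (η⁻¹ * ⟪x - (s + η • c), p - s⟫) = ⟪x - (s + η • c), p - s⟫ := by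
      rw [← mul_assoc, e3, one_mul]
    rw [e4, mul_add, ← mul_assoc, e3] at this
    linarith
  have h5 := h4.trans (real_inner_le_norm _ _)
  rcases (norm_nonneg (p - s)).eq_or_lt with h0 | h0
  · rw [← h0]; simp
  · refine le_of_mul_le_mul_right ?_ h0
    nlinarith

lemma aux_prox_descent {f : E → ℝ} {η : ℝ} {w wp wh g d : E} (hη : 0 < η)
    (hf : ConvexOn ℝ Set.univ f)
    (h1 : ∀ y, f wp + (2 * η)⁻¹ * ‖wp - (w - η • g)‖ ^ 2 ≤
      f y + (2 * η)⁻¹ * ‖y - (w - η • g)‖ ^ 2)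
    (h2 : ∀ y, f wh + (2 * η)⁻¹ * ‖wh - (w - η • d)‖ ^ 2 ≤
      f y + (2 * η)⁻¹ * ‖y - (w - η • d)‖ ^ 2) :
    f wp ≤ f w + η / 2 * ‖g - d‖ ^ 2 - ⟪d, wp - w⟫ - (2 * η)⁻¹ * ‖wp - w‖ ^ 2
      - (2 * η)⁻¹ * ‖w - wh‖ ^ 2 := by
  have hs : StrongConvexOn Set.univ 0 f := strongConvexOn_zero.2 hf
  have a1 := aux_prox hs h1 wh
  have a2 := aux_prox hs h2 w
  set p := wp - w with hp
  set k := w - wh with hk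
  have hcan : ∀ z : E, η⁻¹ • η • z = z := fun z => by
    rw [smul_smul, inv_mul_cancel₀ hη.ne', one_smul]
  have e1 : η⁻¹ • (w - η • g - wp) = -(η⁻¹ • p) - g := by
    rw [show w - η • g - wp = -p - η • g by rw [hp]; abel, smul_sub, hcan, smul_neg]
  have e2 : η⁻¹ • (w - η • d - wh) = η⁻¹ • k - d := by
    rw [show w - η • d - wh = k - η • d by rw [hk]; abel, smul_sub, hcan]
  have e3 : wh - wp = -(k + p) := by rw [hp, hk]; abel
  rw [e1, e3] at a1
  rw [e2] at a2
  have a3 : 0 ≤ ‖η • (g - d) + (k + p)‖ ^ 2 := sq_nonneg _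
  rw [norm_add_sq_real, norm_smul, mul_pow, Real.norm_eq_abs, sq_abs, norm_add_sq_real] at a3
  simp only [inner_sub_left, inner_add_right, inner_neg_right, inner_neg_left, inner_smul_left,
    real_inner_self_eq_norm_sq, conj_trivial] at a1 a2 a3
  rw [real_inner_comm p k] at a3
  have a4 := mul_nonneg (inv_nonneg.2 (by positivity : (0:ℝ) ≤ 2 * η)) a3
  have e5 : η⁻¹ = 2 * (2 * η)⁻¹ := by rw [mul_inv]; ring
  have e6 : (2 * η)⁻¹ * (η ^ 2 * ‖g - d‖ ^ 2 + 2 * (η * (⟪g, k⟫ + ⟪g, p⟫ - (⟪d, k⟫ + ⟪d, p⟫))) +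
      (‖k‖ ^ 2 + 2 * ⟪p, k⟫ + ‖p‖ ^ 2)) = η / 2 * ‖g - d‖ ^ 2 +
      (⟪g, k⟫ + ⟪g, p⟫ - (⟪d, k⟫ + ⟪d, p⟫)) + (2 * η)⁻¹ * (‖k‖ ^ 2 + 2 * ⟪p, k⟫ + ‖p‖ ^ 2) := by
    field_simp
  rw [e5] at a1 a2
  have a5 : 0 ≤ η / 2 * ‖g - d‖ ^ 2 +
      (⟪g, k⟫ + ⟪g, p⟫ - (⟪d, k⟫ + ⟪d, p⟫)) + (2 * η)⁻¹ * (‖k‖ ^ 2 + 2 * ⟪p, k⟫ + ‖p‖ ^ 2) := by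
    rw [← e6]; refine a4.trans (le_of_eq ?_); ring
  nlinarith

end prox

section scalar

lemma aux_scalar_ascent {A B d r e Q : ℝ} (hA : 0 ≤ A) (hB : 0 ≤ B) (hA4 : A ≤ 1 / 4)
    (hX : 0 < A + B) (hd : 0 ≤ d) (hQ : Q ^ 2 * (1 + 7 / 4 * A) ≤ 1)
    (h : (1 + B) * d ≤ Q * r + e) :
    (1 + 3 / 10 * (A + B)) * d ^ 2 ≤ r ^ 2 + 3 / (A + B) * e ^ 2 := by
  set X := A + B with hXd
  have h1 : ((1 + B) * d) ^ 2 ≤ (Q * r + e) ^ 2 := by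
    have : 0 ≤ (1 + B) * d := by positivity
    gcongr
  have h2 : (Q * r + e) ^ 2 ≤ (1 + X / 2) * (Q ^ 2 * r ^ 2) + (1 + 2 / X) * e ^ 2 := by
    have : 0 ≤ X / 2 * (Q * r - 2 / X * e) ^ 2 := by positivity
    have e1 : X / 2 * (Q * r - 2 / X * e) ^ 2 =
        X / 2 * (Q ^ 2 * r ^ 2) - 2 * (Q * r * e) + 2 / X * e ^ 2 := by field_simp; ring
    nlinarith
  have h3 : (1 + 3 / 10 * X) * (1 + X / 2) ≤ (1 + 7 / 4 * A) * (1 + B) ^ 2 := by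
    rw [hXd]; nlinarith [mul_nonneg hA hB, mul_nonneg (mul_nonneg hA hB) hB]
  have h4 : (1 + 3 / 10 * X) * (1 + X / 2) * Q ^ 2 ≤ (1 + B) ^ 2 := by
    calc _ ≤ (1 + 7 / 4 * A) * (1 + B) ^ 2 * Q ^ 2 := by gcongr
      _ = (1 + B) ^ 2 * (Q ^ 2 * (1 + 7 / 4 * A)) := by ring
      _ ≤ (1 + B) ^ 2 * 1 := by gcongr
      _ = _ := by ring
  have h5 : (1 + 3 / 10 * X) * (1 + 2 / X) ≤ 3 / X * (1 + B) ^ 2 := by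
    have e1 : (1 + 3 / 10 * X) * (1 + 2 / X) = ((1 + 3 / 10 * X) * (X + 2)) / X := by field_simp
    have e2 : 3 / X * (1 + B) ^ 2 = (3 * (1 + B) ^ 2) / X := by ring
    rw [e1, e2]
    refine div_le_div_of_nonneg_right ?_ hX.le
    rw [hXd]; nlinarith [mul_nonneg hA hB]
  have h6 : (1 + B) ^ 2 * ((1 + 3 / 10 * X) * d ^ 2) ≤
      (1 + B) ^ 2 * (r ^ 2 + 3 / X * e ^ 2) := by
    calc _ = (1 + 3 / 10 * X) * ((1 + B) * d) ^ 2 := by ring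
      _ ≤ (1 + 3 / 10 * X) * ((1 + X / 2) * (Q ^ 2 * r ^ 2) + (1 + 2 / X) * e ^ 2) := by
          gcongr; exact h1.trans h2
      _ = ((1 + 3 / 10 * X) * (1 + X / 2) * Q ^ 2) * r ^ 2 +
          ((1 + 3 / 10 * X) * (1 + 2 / X)) * e ^ 2 := by ring
      _ ≤ (1 + B) ^ 2 * r ^ 2 + (3 / X * (1 + B) ^ 2) * e ^ 2 := by gcongr
      _ = _ := by ring
  exact le_of_mul_le_mul_left h6 (by positivity)

lemma aux_scalar_p {η lw Lu μ m : ℝ} (hη : 0 < η) (hlw : 0 ≤ lw) (hLu : 0 < Lu) (hμ : 0 < μ)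
    (hm : 0 ≤ m) (hm1 : m ≤ Lu) (hm2 : m ≤ lw) (h1 : lw ^ 2 * η ^ 2 ≤ 1 / 10)
    (h2 : 60 * (Lu / μ) ^ 2 * Lu * η ≤ 1) :
    (lw + m ^ 2 / μ) / 2 + μ / 2 * ((1 + 1 / (2 * (Lu ^ 2 * η / μ))) * (m / μ) ^ 2) ≤
      (2 * η)⁻¹ := by
  set y := η * m ^ 2 / μ with hy
  set x := Lu ^ 2 * η / μ with hx
  set κ := Lu / μ with hκ
  have hx0 : 0 < x := by positivity
  have hκ0 : 0 < κ := by positivity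
  have hy0 : 0 ≤ y := by positivity
  have b1 : lw * η ≤ 317 / 1000 := by
    by_contra hc
    push Not at hc
    nlinarith
  have b2 : y ≤ x := by
    rw [hy, hx, mul_comm]; gcongr
  have b3 : κ * x ≤ 1 / 60 := by
    have : κ * x = κ ^ 2 * Lu * η := by rw [hx, hκ]; field_simp
    rw [this]; linarith
  have b4 : y ≤ lw * η * κ := by
    have : lw * η * κ = η * (lw * Lu) / μ := by rw [hκ]; field_simp
    rw [this, hy, sq]; gcongr
  have b5 : y * y ≤ 317 / 60000 := by
    calc y * y ≤ (lw * η * κ) * x := by gcongr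
      _ = lw * η * (κ * x) := by ring
      _ ≤ 317 / 1000 * (1 / 60) := by gcongr
      _ = _ := by norm_num
  have b6 : y ≤ 73 / 1000 := by
    by_contra hc
    push Not at hc
    nlinarith
  have b7 : y / (2 * x) ≤ 1 / 2 := by
    rw [div_le_iff₀ (by positivity)]; linarith
  have e : (lw + m ^ 2 / μ) / 2 + μ / 2 * ((1 + 1 / (2 * x)) * (m / μ) ^ 2) =
      (2 * η)⁻¹ * (lw * η + y + y + y / (2 * x)) := by
    rw [hy]; field_simp; ring
  rw [e]
  have : (2 * η)⁻¹ * (lw * η + y + y + y / (2 * x)) ≤ (2 * η)⁻¹ * 1 := by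
    gcongr; linarith
  linarith

lemma aux_scalar_final {Psi' Psi η lw Lu μ m Θ σ Λ₀ Λ₁ G2 p2 e2 es2 c2 d2 D D' N : ℝ}
    (hη : 0 < η) (hlw : 0 ≤ lw) (hLu : 0 < Lu) (hμ : 0 < μ)
    (hm : 0 ≤ m) (hm1 : m ≤ Lu) (hm2 : m ≤ lw) (hΘ : 0 ≤ Θ) (hΛ₀ : 1 ≤ Λ₀) (hΛ₁ : 0 ≤ Λ₁)
    (hG2 : 0 ≤ G2) (hp2 : 0 ≤ p2) (hd2 : 0 ≤ d2)
    (hη2 : 10 * Λ₀ * lw ^ 2 * (3 * Θ + 1) * η ^ 2 ≤ 1)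
    (hη1 : 60 * (Lu / μ) ^ 2 * Lu * η ≤ 1)
    (h1 : Psi' ≤ Psi + η / 2 * e2 - η / 2 * G2 - (2 * η)⁻¹ * p2 + (lw + m ^ 2 / μ) / 2 * p2)
    (h2 : e2 ≤ 2 * (Lu ^ 2 * d2) + 2 * es2)
    (h3 : 17 / 20 * es2 ≤ lw ^ 2 * η ^ 2 * (3 / 2 * (Θ * c2 + σ ^ 2) + c2))
    (h4 : c2 ≤ 2 * (Λ₀ * G2 + Λ₁) + 2 * (Lu ^ 2 * d2))
    (h5 : D' ≤ (1 + 2 * (Lu ^ 2 * η / μ)) * d2 +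
      (1 + 1 / (2 * (Lu ^ 2 * η / μ))) * (m / μ) ^ 2 * p2)
    (h6 : (1 + 3 / 10 * (15 * (Lu ^ 2 * η / μ))) * d2 ≤ D + N) :
    Psi' + μ / 2 * D' ≤ Psi + μ / 2 * D - η / 8 * G2 +
      5 * lw ^ 2 * (Λ₁ * (3 * Θ + 1) + 3 * σ ^ 2) * η ^ 3 + μ / 2 * N := by
  have hl : lw ^ 2 * η ^ 2 ≤ 1 / 10 := by
    have : lw ^ 2 * η ^ 2 * 1 ≤ lw ^ 2 * η ^ 2 * (Λ₀ * (3 * Θ + 1)) := by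
      gcongr; nlinarith
    nlinarith
  have hp := mul_le_mul_of_nonneg_right (aux_scalar_p hη hlw hLu hμ hm hm1 hm2 hl hη1) hp2
  set x := Lu ^ 2 * η / μ with hx
  have ex : η * Lu ^ 2 = μ * x := by rw [hx]; field_simp
  -- bound on es2
  set z := lw ^ 2 * η ^ 2 * (3 * Θ + 1) with hz
  have hz0 : 0 ≤ z := by positivity
  have hzΛ : z * Λ₀ ≤ 1 / 10 := by rw [hz]; linarith
  have hz1 : z ≤ 1 / 10 := by nlinarith
  have hLd : 0 ≤ Lu ^ 2 * d2 := by positivity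
  have hσ : 0 ≤ lw ^ 2 * η ^ 2 * σ ^ 2 := by positivity
  have q1 : lw ^ 2 * η ^ 2 * (3 / 2 * (Θ * c2 + σ ^ 2) + c2) ≤
      2 * z * (Λ₀ * G2 + Λ₁ + Lu ^ 2 * d2) + 3 / 2 * (lw ^ 2 * η ^ 2 * σ ^ 2) := by
    have t1 : lw ^ 2 * η ^ 2 * (3 / 2 * Θ + 1) * c2 ≤
        lw ^ 2 * η ^ 2 * (3 / 2 * Θ + 1) * (2 * (Λ₀ * G2 + Λ₁) + 2 * (Lu ^ 2 * d2)) := by gcongr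
    have t2 : lw ^ 2 * η ^ 2 * (3 / 2 * Θ + 1) * (2 * (Λ₀ * G2 + Λ₁) + 2 * (Lu ^ 2 * d2)) ≤
        z * (2 * (Λ₀ * G2 + Λ₁) + 2 * (Lu ^ 2 * d2)) := by
      rw [hz]
      have : 0 ≤ Λ₀ * G2 := by positivity
      gcongr
      linarith
    linarith
  have q2 : z * (Λ₀ * G2) ≤ 1 / 10 * G2 := by
    rw [← mul_assoc]; gcongr
  have q3 : z * (Lu ^ 2 * d2) ≤ 1 / 10 * (Lu ^ 2 * d2) := by gcongr
  have hzl : 0 ≤ z * Λ₁ := by positivity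
  have q4 : es2 ≤ 4 / 17 * G2 + 4 / 17 * (Lu ^ 2 * d2) + 5 * (z * Λ₁) +
      15 * (lw ^ 2 * η ^ 2 * σ ^ 2) := by linarith
  have q5 := mul_le_mul_of_nonneg_left q4 hη.le
  have q6 := mul_le_mul_of_nonneg_left h2 hη.le
  have q7 := mul_le_mul_of_nonneg_left h5 (by positivity : 0 ≤ μ / 2)
  have q8 := mul_le_mul_of_nonneg_left h6 (by positivity : 0 ≤ μ / 2)
  have q9 : η * (Lu ^ 2 * d2) = μ * x * d2 := by rw [← mul_assoc, ex]
  have q10 : 0 ≤ μ * x * d2 := by positivity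
  have q11 : 5 * lw ^ 2 * (Λ₁ * (3 * Θ + 1) + 3 * σ ^ 2) * η ^ 3 =
      η * (5 * (z * Λ₁)) + η * (15 * (lw ^ 2 * η ^ 2 * σ ^ 2)) := by rw [hz]; ring
  have q12 : 0 ≤ η * G2 := by positivity
  rw [q11]
  linarith

end scalar

section avg

lemma aux_pow {a : ℝ} (ha : 0 ≤ a) (ha1 : a ≤ 1) (n : ℕ) : (1 - a) ^ n * (1 + n * a) ≤ 1 := by
  have h1 : 1 + n * a ≤ (1 + a) ^ n := one_add_mul_le_pow (by linarith) n
  have h0 : 0 ≤ 1 - a := by linarith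
  calc (1 - a) ^ n * (1 + n * a) ≤ (1 - a) ^ n * (1 + a) ^ n := by gcongr
    _ = (1 - a ^ 2) ^ n := by rw [← mul_pow]; ring
    _ ≤ 1 := pow_le_one₀ (by nlinarith) (by nlinarith)

variable {E : Type*} [NormedAddCommGroup E] [InnerProductSpace ℝ E]

lemma aux_avg_norm {n : ℕ} (hn : 0 < n) (a : Fin n → E) {C : ℝ} (ha : ∀ i, ‖a i‖ ≤ C) :
    ‖(n : ℝ)⁻¹ • ∑ i, a i‖ ≤ C := by
  have hn' : (0 : ℝ) < n := by exact_mod_cast hn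
  rw [norm_smul, norm_inv, Real.norm_eq_abs, abs_of_pos hn', inv_mul_le_iff₀ hn']
  calc ‖∑ i, a i‖ ≤ ∑ i, ‖a i‖ := norm_sum_le _ _
    _ ≤ ∑ _i : Fin n, C := sum_le_sum fun i _ => ha i
    _ = n * C := by simp

lemma aux_young (x y : E) {a : ℝ} (ha : 0 < a) :
    ‖x + y‖ ^ 2 ≤ (1 + a) * ‖x‖ ^ 2 + (1 + 1 / a) * ‖y‖ ^ 2 := by
  have h1 : ‖x + y‖ ^ 2 ≤ (‖x‖ + ‖y‖) ^ 2 := by gcongr; exact norm_add_le _ _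
  have h2 : 0 ≤ a * (‖x‖ - 1 / a * ‖y‖) ^ 2 := by positivity
  have h3 : a * (‖x‖ - 1 / a * ‖y‖) ^ 2 = a * ‖x‖ ^ 2 - 2 * (‖x‖ * ‖y‖) + 1 / a * ‖y‖ ^ 2 := by
    field_simp; ring
  nlinarith

variable [CompleteSpace E]

lemma aux_avg_grad {n : ℕ} (φ : Fin n → E → ℝ) (g : Fin n → E) (x : E)
    (hg : ∀ i, HasGradientAt (φ i) (g i) x) :
    HasGradientAt (fun y => (n : ℝ)⁻¹ * ∑ i, φ i y) ((n : ℝ)⁻¹ • ∑ i, g i) x := by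
  have h1 := (HasFDerivAt.fun_sum (u := Finset.univ)
    (fun i _ => (hg i).hasFDerivAt)).const_mul (n : ℝ)⁻¹
  rw [hasGradientAt_iff_hasFDerivAt]
  have e : InnerProductSpace.toDual ℝ E ((n : ℝ)⁻¹ • ∑ i, g i) =
      (n : ℝ)⁻¹ • ∑ i, InnerProductSpace.toDual ℝ E (g i) := by
    simp [map_sum]
  rw [e]
  exact h1

lemma aux_descent_lower {φ : E → ℝ} {g : E → E} {L : ℝ} (hg : ∀ x, HasGradientAt φ (g x) x)
    (hL : ∀ x y, ‖g x - g y‖ ≤ L * ‖x - y‖) (x y : E) :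
    φ x + ⟪g x, y - x⟫ - L / 2 * ‖y - x‖ ^ 2 ≤ φ y := by
  have hgn : ∀ x, HasGradientAt (-φ) (-g x) x := by
    intro x
    have := (hg x).hasFDerivAt.neg
    rw [hasGradientAt_iff_hasFDerivAt, map_neg]
    exact this
  have hLn : ∀ x y, ‖-g x - -g y‖ ≤ L * ‖x - y‖ := by
    intro x y
    have := hL x y
    rwa [neg_sub_neg, norm_sub_rev]
  have := aux_descent hgn hLn x y
  simp only [Pi.neg_apply, inner_neg_left] at this
  linarith

lemma aux_ascent (n : ℕ) (hn : 0 < n) (φ : Fin n → E → ℝ) (g : Fin n → E → E) (h : E → ℝ)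
    (L μh μH ηh V : ℝ) (hL0 : 0 < L) (hμh : 0 ≤ μh) (hμH : 0 ≤ μH) (hμ : 0 < μh + μH)
    (hη : 0 < ηh) (hηL : ηh * L ≤ 1 / 4)
    (hs : StrongConvexOn Set.univ μh h) (hsc : ∀ i, StrongConcaveOn Set.univ μH (φ i))
    (hg : ∀ i x, HasGradientAt (φ i) (g i x) x)
    (hL : ∀ i x y, ‖g i x - g i y‖ ≤ L * ‖x - y‖)
    (σ : Equiv.Perm (Fin n)) (U : ℕ → E)
    (hU : ∀ i : Fin n, U ((i : ℕ) + 1) = U (i : ℕ) + (ηh / n) • g (σ i) (U (i : ℕ)))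
    (s c up : E) (hc : c = (n : ℝ)⁻¹ • ∑ i, g i s)
    (hV : (n : ℝ)⁻¹ * ∑ i, ‖g i s - c‖ ^ 2 ≤ V)
    (hsub : ∀ y, h s + ⟪c, y - s⟫ + μh / 2 * ‖y - s‖ ^ 2 ≤ h y)
    (hup : ∀ y, h up + (2 * ηh)⁻¹ * ‖up - U n‖ ^ 2 ≤ h y + (2 * ηh)⁻¹ * ‖y - U n‖ ^ 2) :
    (1 + 3 / 10 * (ηh * (μh + μH))) * ‖up - s‖ ^ 2 ≤ ‖U 0 - s‖ ^ 2 +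
      3 / (ηh * (μh + μH)) * (ηh ^ 4 * L ^ 2 * (2 / 3 * ‖c‖ ^ 2 + V)) := by
  have hn' : (0 : ℝ) < n := by exact_mod_cast hn
  have hn1 : (1 : ℝ) ≤ n := by exact_mod_cast hn
  have hV0 : 0 ≤ V := le_trans (by positivity) hV
  rcases subsingleton_or_nontrivial E with hE | hE
  · have : ‖up - s‖ = 0 := by rw [Subsingleton.elim up s, sub_self, norm_zero]
    rw [this]
    have : 0 ≤ ‖U 0 - s‖ ^ 2 +
      3 / (ηh * (μh + μH)) * (ηh ^ 4 * L ^ 2 * (2 / 3 * ‖c‖ ^ 2 + V)) := by positivity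
    simpa using this
  set γ := ηh / n with hγ
  have hγ0 : 0 < γ := by positivity
  have hγη : γ ≤ ηh := div_le_self hη.le hn1
  have hγL : γ * L ≤ 1 / 4 := le_trans (by gcongr) hηL
  have hstep := fun i x y => aux_step hL0 hγ0.le hγL hμH (hg i) (hL i) (hsc i) x y
  have hμL : μH ≤ L := by
    obtain ⟨x, y, hxy⟩ := exists_pair_ne E
    have h1 := (hstep ⟨0, hn⟩ x y).1
    have h2 : 0 < ‖x - y‖ ^ 2 := by
      have := norm_pos_iff.2 (sub_ne_zero.2 hxy); positivity
    exact le_of_mul_le_mul_right h1 h2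
  have hA4 : ηh * μH ≤ 1 / 4 := le_trans (by gcongr) hηL
  have hγμ : γ * μH ≤ 1 / 4 := le_trans (by gcongr) hγL
  have hγμ0 : 0 ≤ γ * μH := by positivity
  have hq2 : 0 ≤ 1 - 7 / 4 * (γ * μH) := by linarith
  obtain ⟨e, he0, he1, he2⟩ := aux_shuffle_u n hn (fun j => g (σ ⟨j % n, Nat.mod_lt j hn⟩)) L ηh V
    (Real.sqrt (1 - 7 / 4 * (γ * μH))) hL0.le hη.le (Real.sqrt_nonneg _)
    (by rw [Real.sqrt_le_one]; linarith) (fun j x y => hL _ x y)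
    (fun j x y => by
      have h1 := (hstep (σ ⟨j % n, Nat.mod_lt j hn⟩) x y).2
      refine abs_le_of_sq_le_sq' ?_ (by positivity) |>.2
      rw [mul_pow, Real.sq_sqrt hq2]
      exact h1) U
    (fun i hi => by
      have := hU ⟨i, hi⟩
      simp only [Nat.mod_eq_of_lt hi]
      exact this) s c
    (by rw [hc]; congr 1; exact (aux_sum_mod n hn σ (fun i => g i s)).symm)
    (by rwa [aux_sum_mod n hn σ (fun i => ‖g i s - c‖ ^ 2)])
  have h1 := (aux_prox_contr hη hs hup hsub).trans he1
  have h2 := aux_scalar_ascent (A := ηh * μH) (B := ηh * μh) (by positivity) (by positivity) hA4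
    (by rw [← mul_add, add_comm μH]; positivity) (norm_nonneg (up - s)) (by
      rw [← pow_mul, mul_comm n 2, pow_mul, Real.sq_sqrt hq2]
      have := aux_pow (a := 7 / 4 * (γ * μH)) (by positivity) (by linarith) n
      have e : (n : ℝ) * (7 / 4 * (γ * μH)) = 7 / 4 * (ηh * μH) := by rw [hγ]; field_simp
      rwa [e] at this) h1
  rw [← mul_add, add_comm μH] at h2
  refine h2.trans ?_
  gcongr

end avg

lemma aux_first {a b c d : ℝ} (h : a ^ 2 + b ^ 2 ≤ c + d * (0 : ℝ) ^ 2) : a ^ 2 ≤ c := by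
  nlinarith [sq_nonneg b]

lemma aux_second {a b c d : ℝ} (h : a ^ 2 + b ^ 2 ≤ c * (0 : ℝ) ^ 2 + d) : a ^ 2 ≤ d := by
  nlinarith [sq_nonneg b]

lemma aux_first' {a b c d : ℝ} (h : a ^ 2 + b ^ 2 ≤ c + d * (0 : ℝ) ^ 2) : b ^ 2 ≤ c := by
  nlinarith [sq_nonneg a]

lemma aux_second' {a b c d : ℝ} (h : a ^ 2 + b ^ 2 ≤ c * (0 : ℝ) ^ 2 + d) : b ^ 2 ≤ d := by
  nlinarith [sq_nonneg a]

set_option maxHeartbeats 4000000 in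
/-- single-epoch full-shuffling variant of Algorithm 2,
Theorem `th:SGM3_full_shuffling_convergence1`.  Each outer epoch performs
exactly one shuffling gradient-ascent epoch with `η̂ := 15κ²η` followed by one
shuffling descent epoch with `η`; under the NC assumptions, both
gradient-mapping dominations, and the `L_f`-smoothness-type condition on `f`,
for every `T`,
`(1/(T+1)) ∑_{t=0}^T ‖G_η(w̃_t)‖² ≤
  [24(Ψ₀(w̃₀)-Ψ₀*) + 8(Ψ₀(w̃₀)-L(w̃₀,ũ₀))]/(η(T+1)) + 8C_wη² + 8C_uη̂³/η`. -/
theorem single_epoch_full_shuffling_convergence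
    {E F : Type*} [NormedAddCommGroup E] [InnerProductSpace ℝ E] [CompleteSpace E]
    [NormedAddCommGroup F] [InnerProductSpace ℝ F] [CompleteSpace F]
    (n : ℕ) (hn : 0 < n)
    (Hi : Fin n → E → F → ℝ) (Gw : Fin n → E → F → E) (Gu : Fin n → E → F → F)
    (f : E → ℝ) (h : F → ℝ)
    (hf : ConvexOn ℝ Set.univ f)
    (μh μH Lw Lu : ℝ) (hμh : 0 ≤ μh) (hμH : 0 ≤ μH) (hμ : 0 < μh + μH)
    (hsch : StrongConvexOn Set.univ μh h)
    (hscH : ∀ i w, StrongConcaveOn Set.univ μH (Hi i w))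
    (hGw : ∀ i w u, HasGradientAt (fun w' => Hi i w' u) (Gw i w u) w)
    (hGu : ∀ i w u, HasGradientAt (fun u' => Hi i w u') (Gu i w u) u)
    (hLip : ∀ i w u w' u',
      ‖Gw i w u - Gw i w' u'‖ ^ 2 + ‖Gu i w u - Gu i w' u'‖ ^ 2 ≤
        Lw ^ 2 * ‖w - w'‖ ^ 2 + Lu ^ 2 * ‖u - u'‖ ^ 2)
    -- the `L_f`-smoothness-type condition on `f`
    (Lf : ℝ) (hLf : 0 ≤ Lf)
    (hfsmooth : ∀ x y g, SubgradAt f g x →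
      f y ≤ f x + ⟪g, y - x⟫ + Lf / 2 * ‖y - x‖ ^ 2)
    -- component-variance bounds
    (Θw σw Θu σu : ℝ) (hΘw : 0 ≤ Θw) (hσw : 0 ≤ σw) (hΘu : 0 ≤ Θu) (hσu : 0 ≤ σu)
    (hvarw : ∀ w u, (n : ℝ)⁻¹ * ∑ i, ‖Gw i w u - (n : ℝ)⁻¹ • ∑ j, Gw j w u‖ ^ 2 ≤
        Θw * ‖(n : ℝ)⁻¹ • ∑ j, Gw j w u‖ ^ 2 + σw ^ 2)
    (hvaru : ∀ w u, (n : ℝ)⁻¹ * ∑ i, ‖Gu i w u - (n : ℝ)⁻¹ • ∑ j, Gu j w u‖ ^ 2 ≤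
        Θu * ‖(n : ℝ)⁻¹ • ∑ j, Gu j w u‖ ^ 2 + σu ^ 2)
    -- the value function `Φ₀` and its maximizer `u₀*`
    (ustar : E → F)
    (hmax : ∀ w u, (n : ℝ)⁻¹ * ∑ i, Hi i w u - h u ≤
        (n : ℝ)⁻¹ * ∑ i, Hi i w (ustar w) - h (ustar w))
    (Phi0 : E → ℝ)
    (hPhi0 : ∀ w, Phi0 w = (n : ℝ)⁻¹ * ∑ i, Hi i w (ustar w) - h (ustar w))
    (Psi0star : ℝ) (hstar : ∀ w, Psi0star ≤ f w + Phi0 w)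
    -- learning rates, prox operators and the two gradient mappings
    (η ηh : ℝ) (hη0 : 0 < η)
    (hηh : ηh = 15 * (Lu / (μh + μH)) ^ 2 * η)
    (proxf : E → E)
    (hproxf : ∀ x y, f (proxf x) + (2 * η)⁻¹ * ‖proxf x - x‖ ^ 2 ≤
        f y + (2 * η)⁻¹ * ‖y - x‖ ^ 2)
    (proxh : F → F)
    (hproxh : ∀ x y, h (proxh x) + (2 * ηh)⁻¹ * ‖proxh x - x‖ ^ 2 ≤
        h y + (2 * ηh)⁻¹ * ‖y - x‖ ^ 2)
    (Gmap : E → E)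
    (hGmap : ∀ w, Gmap w =
      η⁻¹ • (w - proxf (w - η • ((n : ℝ)⁻¹ • ∑ i, Gw i w (ustar w)))))
    (Ghat : E → F → F)
    (hGhat : ∀ w u, Ghat w u =
      ηh⁻¹ • (u - proxh (u + ηh • ((n : ℝ)⁻¹ • ∑ i, Gu i w u))))
    -- the two gradient-mapping dominations
    (Λ₀ Λ₁ : ℝ) (hΛ₀ : 1 ≤ Λ₀) (hΛ₁ : 0 ≤ Λ₁)
    (hdom : ∀ w, ‖(n : ℝ)⁻¹ • ∑ i, Gw i w (ustar w)‖ ^ 2 ≤ Λ₀ * ‖Gmap w‖ ^ 2 + Λ₁)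
    (Λh₀ Λh₁ : ℝ) (hΛh₀ : 1 ≤ Λh₀) (hΛh₁ : 0 ≤ Λh₁)
    (hdomu : ∀ w u, ‖(n : ℝ)⁻¹ • ∑ i, Gu i w u‖ ^ 2 ≤ Λh₀ * ‖Ghat w u‖ ^ 2 + Λh₁)
    -- step-size conditions
    (hη1 : η ≤ 1 / (60 * (Lu / (μh + μH)) ^ 2 * Lu))
    (hη2 : η ≤ 1 / Real.sqrt (10 * Λ₀ * Lw ^ 2 * (3 * Θw + 1)))
    (hη3 : η ≤ 2 * Real.sqrt Lu /
        ((Lu / (μh + μH)) * Real.sqrt (15 * (4 * Lu ^ 2 + (μh + μH) ^ 2))))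
    (hη4 : η ≤ Real.sqrt Lu / (15 * (Lu / (μh + μH)) *
        Real.sqrt (2 * Lu ^ 3 * Λh₀ * (3 * Θu + 2) + (μh + μH) ^ 2)))
    (hη5 : η ≤ 1 / (4 * ((1 + Lu / (μh + μH)) * Lw) + Lw + Lf))
    -- the iterates: one shuffling ascent epoch and one shuffling descent epoch
    (πu : ℕ → Equiv.Perm (Fin n)) (πh : ℕ → Equiv.Perm (Fin n))
    (wt : ℕ → E) (ut : ℕ → F)
    (U : ℕ → ℕ → F) (W : ℕ → ℕ → E)
    (hU0 : ∀ t, U t 0 = ut t)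
    (hUrec : ∀ t, ∀ i : Fin n, U t ((i : ℕ) + 1) =
      U t (i : ℕ) + (ηh / n) • Gu (πu t i) (wt t) (U t (i : ℕ)))
    (hutstep : ∀ t, ut (t + 1) = proxh (U t n))
    (hW0 : ∀ t, W t 0 = wt t)
    (hWrec : ∀ t, ∀ i : Fin n,
      W t ((i : ℕ) + 1) = W t (i : ℕ) - (η / n) • Gw (πh t i) (W t (i : ℕ)) (ut (t + 1)))
    (hwtstep : ∀ t, wt (t + 1) = proxf (W t n)) :
    ∀ T : ℕ,
      ((T : ℝ) + 1)⁻¹ * ∑ t ∈ Finset.range (T + 1), ‖Gmap (wt t)‖ ^ 2 ≤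
        (24 * (f (wt 0) + Phi0 (wt 0) - Psi0star) +
            8 * ((f (wt 0) + Phi0 (wt 0)) -
              (f (wt 0) + (n : ℝ)⁻¹ * ∑ i, Hi i (wt 0) (ut 0) - h (ut 0)))) /
            (η * ((T : ℝ) + 1)) +
          8 * (5 * Lw ^ 2 * (Λ₁ * (3 * Θw + 1) + 3 * σw ^ 2)) * η ^ 2 +
          8 * (Lu ^ 2 / 2 * (Λh₁ * (3 * Θu + 2) + 3 * σu ^ 2)) * ηh ^ 3 / η := by
  have hn' : (0 : ℝ) < n := by exact_mod_cast hn
  set μ := μh + μH with hμd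
  -- positivity of the constants
  have hLu : 0 < Lu := by
    by_contra hc
    push Not at hc
    have : 1 / (60 * (Lu / μ) ^ 2 * Lu) ≤ 0 :=
      div_nonpos_of_nonneg_of_nonpos zero_le_one
        (mul_nonpos_of_nonneg_of_nonpos (by positivity) hc)
    linarith
  have hη1' : 60 * (Lu / μ) ^ 2 * Lu * η ≤ 1 := by
    rw [le_div_iff₀ (by positivity)] at hη1
    linarith
  have hη2' : 10 * Λ₀ * |Lw| ^ 2 * (3 * Θw + 1) * η ^ 2 ≤ 1 := by
    rw [sq_abs]
    set Z := 10 * Λ₀ * Lw ^ 2 * (3 * Θw + 1) with hZ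
    have hZ0 : 0 ≤ Z := by positivity
    have hsq : 0 < Real.sqrt Z := by
      rcases (Real.sqrt_nonneg Z).eq_or_lt with h0 | h0
      · rw [← h0, div_zero] at hη2; linarith
      · exact h0
    rw [le_div_iff₀ hsq] at hη2
    calc Z * η ^ 2 = (η * Real.sqrt Z) ^ 2 := by rw [mul_pow, Real.sq_sqrt hZ0]; ring
      _ ≤ 1 := by
        have : 0 ≤ η * Real.sqrt Z := by positivity
        exact pow_le_one₀ this hη2
  have hlw2 : Lw ^ 2 * η ^ 2 ≤ 1 / 10 := by
    have h1 : Lw ^ 2 * η ^ 2 * 1 ≤ Lw ^ 2 * η ^ 2 * (Λ₀ * (3 * Θw + 1)) := by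
      gcongr
      exact one_le_mul_of_one_le_of_one_le hΛ₀ (by linarith)
    rw [sq_abs] at hη2'
    linarith
  have hηh0 : 0 < ηh := by rw [hηh]; positivity
  have hηhL : ηh * Lu ≤ 1 / 4 := by rw [hηh]; linarith
  -- averages
  let H : E → F → ℝ := fun w u => (n : ℝ)⁻¹ * ∑ i, Hi i w u
  let gw : E → F → E := fun w u => (n : ℝ)⁻¹ • ∑ i, Gw i w u
  let gu : E → F → F := fun w u => (n : ℝ)⁻¹ • ∑ i, Gu i w u
  have hHw : ∀ u w, HasGradientAt (fun w => H w u) (gw w u) w := fun u w =>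
    aux_avg_grad (fun i w => Hi i w u) (fun i => Gw i w u) w (fun i => hGw i w u)
  have hHu : ∀ w u, HasGradientAt (fun u => H w u) (gu w u) u := fun w u =>
    aux_avg_grad (fun i u => Hi i w u) (fun i => Gu i w u) u (fun i => hGu i w u)
  have hLww : ∀ i w w' u, ‖Gw i w u - Gw i w' u‖ ≤ |Lw| * ‖w - w'‖ := by
    intro i w w' u
    have h1 := hLip i w u w' u
    refine (abs_le_of_sq_le_sq' ?_ (by positivity)).2
    rw [mul_pow, sq_abs]
    simp only [sub_self, norm_zero] at h1
    exact aux_first h1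
  have hLwu : ∀ i w u u', ‖Gw i w u - Gw i w u'‖ ≤ Lu * ‖u - u'‖ := by
    intro i w u u'
    have h1 := hLip i w u w u'
    refine (abs_le_of_sq_le_sq' ?_ (by positivity)).2
    rw [mul_pow]
    simp only [sub_self, norm_zero] at h1
    exact aux_second h1
  have hLuw : ∀ i w w' u, ‖Gu i w u - Gu i w' u‖ ≤ |Lw| * ‖w - w'‖ := by
    intro i w w' u
    have h1 := hLip i w u w' u
    refine (abs_le_of_sq_le_sq' ?_ (by positivity)).2
    rw [mul_pow, sq_abs]
    simp only [sub_self, norm_zero] at h1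
    exact aux_first' h1
  have hLuu : ∀ i w u u', ‖Gu i w u - Gu i w u'‖ ≤ Lu * ‖u - u'‖ := by
    intro i w u u'
    have h1 := hLip i w u w u'
    refine (abs_le_of_sq_le_sq' ?_ (by positivity)).2
    rw [mul_pow]
    simp only [sub_self, norm_zero] at h1
    exact aux_second' h1
  have hgww : ∀ w w' u, ‖gw w u - gw w' u‖ ≤ |Lw| * ‖w - w'‖ := by
    intro w w' u
    simp only [gw, ← smul_sub, ← sum_sub_distrib]
    exact aux_avg_norm hn _ fun i => hLww i w w' u
  have hgwu : ∀ w u u', ‖gw w u - gw w u'‖ ≤ Lu * ‖u - u'‖ := by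
    intro w u u'
    simp only [gw, ← smul_sub, ← sum_sub_distrib]
    exact aux_avg_norm hn _ fun i => hLwu i w u u'
  have hguw : ∀ w w' u, ‖gu w u - gu w' u‖ ≤ |Lw| * ‖w - w'‖ := by
    intro w w' u
    simp only [gu, ← smul_sub, ← sum_sub_distrib]
    exact aux_avg_norm hn _ fun i => hLuw i w w' u
  have hguu : ∀ w u u', ‖gu w u - gu w u'‖ ≤ Lu * ‖u - u'‖ := by
    intro w u u'
    simp only [gu, ← smul_sub, ← sum_sub_distrib]
    exact aux_avg_norm hn _ fun i => hLuu i w u u'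
  -- mixed second difference
  set m := min Lu |Lw| with hm
  have hm0 : 0 ≤ m := le_min hLu.le (abs_nonneg _)
  have hm1 : m ≤ Lu := min_le_left _ _
  have hm2 : m ≤ |Lw| := min_le_right _ _
  have hmix : ∀ w w' u u', H w' u' - H w u' - (H w' u - H w u) ≤ m * (‖w' - w‖ * ‖u' - u‖) := by
    intro w w' u u'
    have h1 : (H w' u' - H w' u) - (H w u' - H w u) ≤ Lu * ‖u' - u‖ * ‖w' - w‖ :=
      aux_mvt (φ := fun z => H z u' - H z u) (g := fun z => gw z u' - gw z u)
        (fun z => by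
          have := (hHw u' z).hasFDerivAt.sub (hHw u z).hasFDerivAt
          rw [hasGradientAt_iff_hasFDerivAt, map_sub]
          exact this) (fun z => hgwu z u' u) w w'
    have h2 : (H w' u' - H w u') - (H w' u - H w u) ≤ |Lw| * ‖w' - w‖ * ‖u' - u‖ :=
      aux_mvt (φ := fun z => H w' z - H w z) (g := fun z => gu w' z - gu w z)
        (fun z => by
          have := (hHu w' z).hasFDerivAt.sub (hHu w z).hasFDerivAt
          rw [hasGradientAt_iff_hasFDerivAt, map_sub]
          exact this) (fun z => hguw w' w z) u u'
    rcases min_choice Lu |Lw| with hh | hh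
    · rw [hm, hh]; linarith
    · rw [hm, hh]; linarith
  -- strong concavity and quadratic growth
  have hgrow : ∀ w u, H w u - h u + μ / 2 * ‖u - ustar w‖ ^ 2 ≤
      H w (ustar w) - h (ustar w) := by
    intro w u
    have hsc : StrongConvexOn Set.univ μ (fun u => h u - H w u) := by
      refine ⟨convex_univ, fun x _ y _ a b ha hb hab => ?_⟩
      have h1 := hsch.2 (Set.mem_univ x) (Set.mem_univ y) ha hb hab
      have h2 : ∀ i, a * Hi i w x + b * Hi i w y + a * b * (μH / 2 * ‖x - y‖ ^ 2) ≤
          Hi i w (a • x + b • y) := by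
        intro i
        have := (hscH i w).2 (Set.mem_univ x) (Set.mem_univ y) ha hb hab
        simpa only [smul_eq_mul] using this
      have h3 := sum_le_sum fun i (_ : i ∈ Finset.univ) => h2 i
      rw [sum_add_distrib, sum_add_distrib, ← mul_sum, ← mul_sum, sum_const, card_univ,
        Fintype.card_fin, nsmul_eq_mul] at h3
      have h4 := mul_le_mul_of_nonneg_left h3 (inv_nonneg.2 hn'.le)
      have h5 : (n : ℝ)⁻¹ * (a * ∑ i, Hi i w x + b * ∑ i, Hi i w y +
          n * (a * b * (μH / 2 * ‖x - y‖ ^ 2))) =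
          a * H w x + b * H w y + a * b * (μH / 2 * ‖x - y‖ ^ 2) := by
        simp only [H]; field_simp
      rw [h5] at h4
      simp only [smul_eq_mul] at h1 ⊢
      have h6 : (n : ℝ)⁻¹ * ∑ i, Hi i w (a • x + b • y) = H w (a • x + b • y) := rfl
      rw [h6] at h4
      rw [hμd]
      linarith
    have h1 := aux_strong_subgrad (p := ustar w) (g := 0) (C := 0) hsc (fun y => by
      have : H w y - h y ≤ H w (ustar w) - h (ustar w) := hmax w y
      simp only [inner_zero_left, zero_mul]
      linarith) u
    simp only [inner_zero_left] at h1
    linarith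
  -- strong subgradient of `h` at the maximizer
  have hsub : ∀ w y, h (ustar w) + ⟪gu w (ustar w), y - ustar w⟫ +
      μh / 2 * ‖y - ustar w‖ ^ 2 ≤ h y := by
    intro w
    refine aux_strong_subgrad (C := Lu / 2) hsch fun y => ?_
    have h1 : H w y - h y ≤ H w (ustar w) - h (ustar w) := hmax w y
    have h2 := aux_descent_lower (φ := fun u => H w u) (g := fun u => gu w u) (hHu w)
      (fun x y => hguu w x y) (ustar w) y
    linarith
  have hgu2 : ∀ w, ‖gu w (ustar w)‖ ^ 2 ≤ Λh₁ := by
    intro w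
    have h1 := hdomu w (ustar w)
    have h2 := aux_prox_contr hηh0 hsch (hproxh (ustar w + ηh • gu w (ustar w))) (hsub w)
    rw [sub_self, norm_zero] at h2
    have h3 : ‖proxh (ustar w + ηh • gu w (ustar w)) - ustar w‖ ≤ 0 := by
      have h4 : 0 ≤ ηh * μh := by positivity
      exact le_of_mul_le_mul_left (by rw [mul_zero]; linarith) (by linarith : 0 < 1 + ηh * μh)
    have h5 : Ghat w (ustar w) = 0 := by
      rw [hGhat, ← neg_sub, norm_le_zero_iff.1 h3, neg_zero, smul_zero]
    rw [h5, norm_zero] at h1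
    have h6 : ‖gu w (ustar w)‖ ^ 2 = ‖(n : ℝ)⁻¹ • ∑ i, Gu i w (ustar w)‖ ^ 2 := rfl
    rw [h6]; linarith
  -- Lipschitz continuity of the maximizer
  have hust : ∀ w w', ‖ustar w' - ustar w‖ ≤ m / μ * ‖w' - w‖ := by
    intro w w'
    have h1 := hgrow w (ustar w')
    have h2 := hgrow w' (ustar w)
    rw [norm_sub_rev (ustar w)] at h2
    have h3 := hmix w w' (ustar w) (ustar w')
    have h4 : μ * ‖ustar w' - ustar w‖ * ‖ustar w' - ustar w‖ ≤
        m * ‖w' - w‖ * ‖ustar w' - ustar w‖ := by rw [mul_assoc, ← sq]; linarith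
    rw [div_mul_eq_mul_div, le_div_iff₀ hμ]
    rcases (norm_nonneg (ustar w' - ustar w)).eq_or_lt with h0 | h0
    · rw [← h0, zero_mul]; positivity
    · linarith [le_of_mul_le_mul_right h4 h0]
  -- smoothness of `Φ₀`
  have hPhi : ∀ w w', Phi0 w' ≤ Phi0 w + ⟪gw w (ustar w), w' - w⟫ +
      (|Lw| + m ^ 2 / μ) / 2 * ‖w' - w‖ ^ 2 := by
    intro w w'
    have e1 : Phi0 w = H w (ustar w) - h (ustar w) := hPhi0 w
    have e2 : Phi0 w' = H w' (ustar w') - h (ustar w') := hPhi0 w'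
    have h1 := hgrow w (ustar w')
    have h3 := hmix w w' (ustar w) (ustar w')
    have h4 := aux_descent (φ := fun z => H z (ustar w)) (g := fun z => gw z (ustar w))
      (hHw (ustar w)) (fun x y => hgww x y (ustar w)) w w'
    have h5 : 0 ≤ μ / 2 * (‖ustar w' - ustar w‖ - m / μ * ‖w' - w‖) ^ 2 := by positivity
    have h6 : μ / 2 * (‖ustar w' - ustar w‖ - m / μ * ‖w' - w‖) ^ 2 =
        μ / 2 * ‖ustar w' - ustar w‖ ^ 2 - m * (‖w' - w‖ * ‖ustar w' - ustar w‖) +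
        m ^ 2 / μ / 2 * ‖w' - w‖ ^ 2 := by field_simp; ring
    rw [e1, e2]
    linarith
  -- noise level of the ascent step
  set M := Λh₁ * (3 * Θu + 2) + 3 * σu ^ 2 with hM
  set N := ηh ^ 3 * Lu ^ 2 * M / μ with hN
  have hηhμ : ηh * μ = 15 * (Lu ^ 2 * η / μ) := by rw [hηh]; field_simp
  have hasc : ∀ t, (1 + 3 / 10 * (15 * (Lu ^ 2 * η / μ))) * ‖ut (t + 1) - ustar (wt t)‖ ^ 2 ≤
      ‖ut t - ustar (wt t)‖ ^ 2 + N := by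
    intro t
    have h1 := aux_ascent n hn (fun i u => Hi i (wt t) u) (fun i u => Gu i (wt t) u) h Lu μh μH ηh
      (Θu * ‖gu (wt t) (ustar (wt t))‖ ^ 2 + σu ^ 2) hLu hμh hμH hμ hηh0 hηhL hsch
      (fun i => hscH i (wt t)) (fun i u => hGu i (wt t) u) (fun i u u' => hLuu i (wt t) u u')
      (πu t) (U t) (hUrec t) (ustar (wt t)) (gu (wt t) (ustar (wt t))) (ut (t + 1)) rfl
      (hvaru (wt t) (ustar (wt t))) (hsub (wt t))
      (fun y => by rw [hutstep t]; exact hproxh (U t n) y)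
    rw [← hμd, hU0 t, hηhμ] at h1
    refine h1.trans ?_
    have h2 : 2 / 3 * ‖gu (wt t) (ustar (wt t))‖ ^ 2 +
        (Θu * ‖gu (wt t) (ustar (wt t))‖ ^ 2 + σu ^ 2) ≤ M / 3 := by
      have := hgu2 (wt t)
      have h3 := mul_le_mul_of_nonneg_left this hΘu
      rw [hM]; linarith
    rw [← hηhμ]
    have h4 : 3 / (ηh * μ) * (ηh ^ 4 * Lu ^ 2 * (2 / 3 * ‖gu (wt t) (ustar (wt t))‖ ^ 2 +
        (Θu * ‖gu (wt t) (ustar (wt t))‖ ^ 2 + σu ^ 2))) ≤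
        3 / (ηh * μ) * (ηh ^ 4 * Lu ^ 2 * (M / 3)) := by gcongr
    have h5 : 3 / (ηh * μ) * (ηh ^ 4 * Lu ^ 2 * (M / 3)) = N := by
      rw [hN]; field_simp
    linarith
  -- one outer epoch
  have hone : ∀ t, (f (wt (t + 1)) + Phi0 (wt (t + 1))) +
        μ / 2 * ‖ut (t + 1) - ustar (wt (t + 1))‖ ^ 2 ≤
      (f (wt t) + Phi0 (wt t)) + μ / 2 * ‖ut t - ustar (wt t)‖ ^ 2 - η / 8 * ‖Gmap (wt t)‖ ^ 2 +
        5 * |Lw| ^ 2 * (Λ₁ * (3 * Θw + 1) + 3 * σw ^ 2) * η ^ 3 + μ / 2 * N := by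
    intro t
    obtain ⟨g, hg1, hg2⟩ := aux_shuffle_w n hn
      (fun j w => Gw (πh t ⟨j % n, Nat.mod_lt j hn⟩) w (ut (t + 1))) |Lw| η
      (Θw * ‖gw (wt t) (ut (t + 1))‖ ^ 2 + σw ^ 2)
      (fun j x y => by rw [← mul_pow]; gcongr; exact hLww _ x y _) (W t)
      (fun i hi => by
        have := hWrec t ⟨i, hi⟩
        simp only [Nat.mod_eq_of_lt hi]
        exact this) (gw (wt t) (ut (t + 1)))
      (by
        rw [hW0, aux_sum_mod n hn (πh t) (fun i => Gw i (wt t) (ut (t + 1)))])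
      (by
        rw [hW0, aux_sum_mod n hn (πh t)
          (fun i => ‖Gw i (wt t) (ut (t + 1)) - gw (wt t) (ut (t + 1))‖ ^ 2)]
        exact hvarw (wt t) (ut (t + 1)))
      (by rw [sq_abs]; exact hlw2)
    rw [hW0] at hg1
    have hd := aux_prox_descent (w := wt t) (wp := wt (t + 1)) (g := g)
      (d := gw (wt t) (ustar (wt t)))
      (wh := proxf (wt t - η • gw (wt t) (ustar (wt t)))) hη0 hf
      (fun y => by rw [hwtstep t, hg1]; exact hproxf _ y) (fun y => hproxf _ y)
    have hG : wt t - proxf (wt t - η • gw (wt t) (ustar (wt t))) = η • Gmap (wt t) := by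
      rw [hGmap, smul_inv_smul₀ hη0.ne']
    rw [hG, norm_smul, mul_pow, Real.norm_eq_abs, sq_abs] at hd
    have hG2 : (2 * η)⁻¹ * (η ^ 2 * ‖Gmap (wt t)‖ ^ 2) = η / 2 * ‖Gmap (wt t)‖ ^ 2 := by
      field_simp
    rw [hG2] at hd
    have hP := hPhi (wt t) (wt (t + 1))
    have hx0 : 0 < 2 * (Lu ^ 2 * η / μ) := by positivity
    have hgd : ‖gw (wt t) (ut (t + 1)) - gw (wt t) (ustar (wt t))‖ ^ 2 ≤
        Lu ^ 2 * ‖ut (t + 1) - ustar (wt t)‖ ^ 2 := by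
      rw [← mul_pow]; gcongr; exact hgwu _ _ _
    refine aux_scalar_final (e2 := ‖g - gw (wt t) (ustar (wt t))‖ ^ 2)
      (es2 := ‖g - gw (wt t) (ut (t + 1))‖ ^ 2) (c2 := ‖gw (wt t) (ut (t + 1))‖ ^ 2)
      (p2 := ‖wt (t + 1) - wt t‖ ^ 2) (d2 := ‖ut (t + 1) - ustar (wt t)‖ ^ 2) (Λ₀ := Λ₀)
      hη0 (abs_nonneg Lw) hLu hμ hm0 hm1 hm2 hΘw hΛ₀ hΛ₁ (sq_nonneg _) (sq_nonneg _) (sq_nonneg _)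
      hη2' hη1' ?_ ?_ hg2 ?_ ?_ (hasc t)
    · linarith
    · have h1 := aux_sq2 (g - gw (wt t) (ut (t + 1)))
        (gw (wt t) (ut (t + 1)) - gw (wt t) (ustar (wt t)))
      rw [sub_add_sub_cancel] at h1
      linarith
    · have h1 := aux_sq2 (gw (wt t) (ustar (wt t)))
        (gw (wt t) (ut (t + 1)) - gw (wt t) (ustar (wt t)))
      rw [add_sub_cancel] at h1
      have h2 : ‖gw (wt t) (ustar (wt t))‖ ^ 2 ≤ Λ₀ * ‖Gmap (wt t)‖ ^ 2 + Λ₁ := hdom (wt t)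
      linarith
    · have h1 := aux_young (ut (t + 1) - ustar (wt t)) (ustar (wt t) - ustar (wt (t + 1))) hx0
      rw [sub_add_sub_cancel, norm_sub_rev (ustar (wt t))] at h1
      refine h1.trans ?_
      rw [mul_assoc _ ((m / μ) ^ 2), ← mul_pow]
      have h2 := hust (wt t) (wt (t + 1))
      gcongr
  -- telescoping
  set R := 5 * Lw ^ 2 * (Λ₁ * (3 * Θw + 1) + 3 * σw ^ 2) * η ^ 3 + μ / 2 * N with hR
  have htel : ∀ T : ℕ, ∑ t ∈ Finset.range T, ‖Gmap (wt t)‖ ^ 2 * (η / 8) ≤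
      (f (wt 0) + Phi0 (wt 0)) + μ / 2 * ‖ut 0 - ustar (wt 0)‖ ^ 2 + T * R -
      ((f (wt T) + Phi0 (wt T)) + μ / 2 * ‖ut T - ustar (wt T)‖ ^ 2) := by
    intro T
    induction T with
    | zero => simp
    | succ k ih =>
      rw [sum_range_succ]
      have := hone k
      rw [sq_abs] at this
      push_cast
      linarith
  intro T
  have h1 := htel (T + 1)
  rw [← sum_mul] at h1
  set S := ∑ t ∈ Finset.range (T + 1), ‖Gmap (wt t)‖ ^ 2 with hS
  have h2 := hstar (wt (T + 1))
  have h3 := hstar (wt 0)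
  have h4 : 0 ≤ μ / 2 * ‖ut (T + 1) - ustar (wt (T + 1))‖ ^ 2 := by positivity
  have h5 : μ / 2 * ‖ut 0 - ustar (wt 0)‖ ^ 2 ≤ (f (wt 0) + Phi0 (wt 0)) -
      (f (wt 0) + (n : ℝ)⁻¹ * ∑ i, Hi i (wt 0) (ut 0) - h (ut 0)) := by
    have a1 := hgrow (wt 0) (ut 0)
    have a2 : Phi0 (wt 0) = H (wt 0) (ustar (wt 0)) - h (ustar (wt 0)) := hPhi0 (wt 0)
    have a3 : (n : ℝ)⁻¹ * ∑ i, Hi i (wt 0) (ut 0) = H (wt 0) (ut 0) := rfl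
    rw [a3, a2]; linarith
  set B := (f (wt 0) + Phi0 (wt 0)) -
      (f (wt 0) + (n : ℝ)⁻¹ * ∑ i, Hi i (wt 0) (ut 0) - h (ut 0)) with hB
  set A := f (wt 0) + Phi0 (wt 0) - Psi0star with hA
  push_cast at h1
  have hT : (0 : ℝ) < T + 1 := by positivity
  have h6 : S * (η / 8) ≤ 3 * A + B + (T + 1) * R := by
    have : 0 ≤ A := by rw [hA]; linarith
    have : A = f (wt 0) + Phi0 (wt 0) - Psi0star := hA
    linarith
  have h7 : (24 * A + 8 * B) / (η * ((T : ℝ) + 1)) +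
          8 * (5 * Lw ^ 2 * (Λ₁ * (3 * Θw + 1) + 3 * σw ^ 2)) * η ^ 2 +
          8 * (Lu ^ 2 / 2 * M) * ηh ^ 3 / η =
      ((T : ℝ) + 1)⁻¹ * ((3 * A + B + (T + 1) * R) * (8 / η)) := by
    rw [hR, hN]; field_simp; ring
  rw [h7]
  gcongr
  calc S = S * (η / 8) * (8 / η) := by field_simp
    _ ≤ _ := by gcongr
end

section
/- (Shuffling descent epoch estimates.) Under the NC assumptions and the component-variance bound in w, fix w̃, ũ ∈ dom L, a permutation π̂ of {1,…,n}, and a stepsize η with 1 − 3L_w²η² ≥ 0. Define w₀ := w̃ and w_i := w_{i−1} − (η/n)∇_wH_{π̂(i)}(w_{i−1}, ũ) for i = 1,…,n, and let g := (1/n)∑_{j=1}^n ∇_wH_{π̂(j)}(w_{j−1}, ũ). Then: (i) Δ := (1/n)∑_{i=0}^{n−1}‖w_i − w₀‖² ≤ 2(3Θ_w+1)η²‖∇Φ₀(w̃)‖² + 6η²σ_w² + 4L_u²η²‖ũ − u₀*(w̃)‖²; (ii) ‖g − ∇_wH(w̃,ũ)‖² ≤ L_w²Δ; (iii) ‖∇_wH(w̃,ũ)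 − ∇Φ₀(w̃)‖² ≤ L_u²‖ũ − u₀*(w̃)‖²; and (iv) ‖g − ∇Φ₀(w̃)‖² ≤ L_w²Δ + L_u²‖ũ − u₀*(w̃)‖². -/
theorem aux_norm_sum_sq_s17 {ι E : Type*} [NormedAddCommGroup E] (s : Finset ι) (f : ι → E) :
    ‖∑ i ∈ s, f i‖ ^ 2 ≤ (s.card : ℝ) * ∑ i ∈ s, ‖f i‖ ^ 2 :=
  (pow_le_pow_left₀ (norm_nonneg _) (norm_sum_le s f) 2).trans sq_sum_le_card_mul_sum_sq

theorem aux_three {E : Type*} [NormedAddCommGroup E] (a b c : E) :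
    ‖a + b + c‖ ^ 2 ≤ 3 * (‖a‖ ^ 2 + ‖b‖ ^ 2 + ‖c‖ ^ 2) := by
  have h := norm_add₃_le (a := a) (b := b) (c := c)
  have h2 := pow_le_pow_left₀ (norm_nonneg _) h 2
  nlinarith [sq_nonneg (‖a‖ - ‖b‖), sq_nonneg (‖a‖ - ‖c‖), sq_nonneg (‖b‖ - ‖c‖)]

theorem aux_mean {E : Type*} [NormedAddCommGroup E] [InnerProductSpace ℝ E] (n : ℕ) (hn : 0 < n)
    (f : Fin n → E) : ‖(n : ℝ)⁻¹ • ∑ i, f i‖ ^ 2 ≤ (n : ℝ)⁻¹ * ∑ i, ‖f i‖ ^ 2 := by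
  have hn' : (0 : ℝ) < n := by exact_mod_cast hn
  have h := aux_norm_sum_sq_s17 Finset.univ f
  rw [Finset.card_univ, Fintype.card_fin] at h
  rw [norm_smul, mul_pow, Real.norm_eq_abs, sq_abs]
  calc ((n : ℝ)⁻¹) ^ 2 * ‖∑ i, f i‖ ^ 2 ≤ ((n : ℝ)⁻¹) ^ 2 * ((n : ℝ) * ∑ i, ‖f i‖ ^ 2) := by gcongr
    _ = _ := by field_simp

theorem aux_sum1 (n : ℕ) : ∑ i ∈ Finset.range n, (i : ℝ) ≤ (n : ℝ) ^ 2 / 2 := by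
  induction n with
  | zero => simp
  | succ k ih => rw [Finset.sum_range_succ]; push_cast; nlinarith

theorem aux_sum2 (n : ℕ) : ∑ i ∈ Finset.range n, (i : ℝ) ^ 2 ≤ (n : ℝ) ^ 3 / 3 := by
  induction n with
  | zero => simp
  | succ k ih =>
    rw [Finset.sum_range_succ]; push_cast
    have : (0 : ℝ) ≤ k := Nat.cast_nonneg k
    nlinarith

theorem aux_partial {E : Type*} [NormedAddCommGroup E] [InnerProductSpace ℝ E] (n : ℕ)
    (x y : ℕ → E) (b : E) (k : ℕ) (hk : k ≤ n) :
    ‖∑ j ∈ Finset.range k, (x j + y j + b)‖ ^ 2 ≤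
      3 * ((k : ℝ) * ∑ j ∈ Finset.range n, ‖x j‖ ^ 2 + (k : ℝ) * ∑ j ∈ Finset.range n, ‖y j‖ ^ 2
        + (k : ℝ) ^ 2 * ‖b‖ ^ 2) := by
  have hx : ∀ z : ℕ → E, ‖∑ j ∈ Finset.range k, z j‖ ^ 2 ≤
      (k : ℝ) * ∑ j ∈ Finset.range n, ‖z j‖ ^ 2 := by
    intro z
    have h := aux_norm_sum_sq_s17 (Finset.range k) z
    rw [Finset.card_range] at h
    refine h.trans ?_
    gcongr
  have hb : ‖(k : ℝ) • b‖ ^ 2 = (k : ℝ) ^ 2 * ‖b‖ ^ 2 := by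
    rw [norm_smul, mul_pow, Real.norm_eq_abs, sq_abs]
  have e : ∑ j ∈ Finset.range k, (x j + y j + b) =
      ∑ j ∈ Finset.range k, x j + ∑ j ∈ Finset.range k, y j + (k : ℝ) • b := by
    rw [Finset.sum_add_distrib, Finset.sum_add_distrib, Finset.sum_const, Finset.card_range,
      Nat.cast_smul_eq_nsmul]
  rw [e]
  refine (aux_three _ _ _).trans ?_
  rw [hb]
  have h1 := hx x
  have h2 := hx y
  linarith

/-- drift bound for an abstract recursion -/
theorem aux_drift {E : Type*} [NormedAddCommGroup E] [InnerProductSpace ℝ E] (n : ℕ) (hn : 0 < n)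
    (W x y : ℕ → E) (b : E) (η X Y : ℝ)
    (hrec : ∀ i < n, W (i + 1) = W i - (η / n) • (x i + y i + b))
    (hX : ∑ j ∈ Finset.range n, ‖x j‖ ^ 2 ≤ n * X)
    (hY : ∑ j ∈ Finset.range n, ‖y j‖ ^ 2 ≤ n * Y) :
    (n : ℝ)⁻¹ * ∑ i ∈ Finset.range n, ‖W i - W 0‖ ^ 2 ≤
      η ^ 2 * (3 / 2 * X + 3 / 2 * Y + ‖b‖ ^ 2) := by
  have hn' : (0 : ℝ) < n := by exact_mod_cast hn
  have hsum : ∀ k ≤ n, W k - W 0 = -((η / n) • ∑ j ∈ Finset.range k, (x j + y j + b)) := by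
    intro k
    induction k with
    | zero => simp
    | succ k ih =>
      intro hk
      rw [Finset.sum_range_succ, smul_add, hrec k (by omega), neg_add, ← ih (by omega)]
      abel
  have hX0 : 0 ≤ X := by
    have : 0 ≤ (n : ℝ) * X := le_trans (Finset.sum_nonneg fun _ _ => by positivity) hX
    exact nonneg_of_mul_nonneg_right this hn'
  have hY0 : 0 ≤ Y := by
    have : 0 ≤ (n : ℝ) * Y := le_trans (Finset.sum_nonneg fun _ _ => by positivity) hY
    exact nonneg_of_mul_nonneg_right this hn'
  have hk : ∀ k ∈ Finset.range n, ‖W k - W 0‖ ^ 2 ≤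
      (η / n) ^ 2 * (3 * n * (X + Y)) * (k : ℝ) + (η / n) ^ 2 * (3 * ‖b‖ ^ 2) * (k : ℝ) ^ 2 := by
    intro k hk
    have hk' : k ≤ n := (Finset.mem_range.mp hk).le
    rw [hsum k hk', norm_neg, norm_smul, mul_pow, Real.norm_eq_abs, sq_abs]
    have h := aux_partial n x y b k hk'
    have h1 : (k : ℝ) * ∑ j ∈ Finset.range n, ‖x j‖ ^ 2 ≤ k * (n * X) := by gcongr
    have h2 : (k : ℝ) * ∑ j ∈ Finset.range n, ‖y j‖ ^ 2 ≤ k * (n * Y) := by gcongr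
    calc _ ≤ (η / n) ^ 2 * (3 * (k * (n * X) + k * (n * Y) + (k : ℝ) ^ 2 * ‖b‖ ^ 2)) := by
          gcongr; linarith
      _ = _ := by ring
  have hS := Finset.sum_le_sum hk
  rw [Finset.sum_add_distrib, ← Finset.mul_sum, ← Finset.mul_sum] at hS
  have s1 := aux_sum1 n
  have s2 := aux_sum2 n
  calc _ ≤ (n : ℝ)⁻¹ * ((η / n) ^ 2 * (3 * n * (X + Y)) * ((n : ℝ) ^ 2 / 2)
        + (η / n) ^ 2 * (3 * ‖b‖ ^ 2) * ((n : ℝ) ^ 3 / 3)) := by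
        gcongr
        refine hS.trans ?_
        gcongr
    _ = _ := by field_simp

/-- estimates for one shuffling descent epoch in `w`,
Lemma `le:SGM2_key_bounds_for_wt_2`.  Under the NC assumptions and the
component-variance bound in `w`, one shuffling epoch
`w_i := w_{i-1} - (η/n) ∇_w H_{π̂(i)}(w_{i-1}, ũ)` from `w₀ = w̃` with
`1 - 3L_w²η² ≥ 0` satisfies the four estimates (i)–(iv). -/
theorem shuffling_descent_epoch_estimates
    {E F : Type*} [NormedAddCommGroup E] [InnerProductSpace ℝ E] [CompleteSpace E]
    [NormedAddCommGroup F] [InnerProductSpace ℝ F] [CompleteSpace F]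
    (n : ℕ) (hn : 0 < n)
    (Hi : Fin n → E → F → ℝ) (Gw : Fin n → E → F → E) (Gu : Fin n → E → F → F)
    (h : F → ℝ)
    (μh μH Lw Lu : ℝ) (hμh : 0 ≤ μh) (hμH : 0 ≤ μH) (hμ : 0 < μH + μh)
    (hsch : StrongConvexOn Set.univ μh h)
    (hscH : ∀ i w, StrongConcaveOn Set.univ μH (Hi i w))
    (hGw : ∀ i w u, HasGradientAt (fun w' => Hi i w' u) (Gw i w u) w)
    (hGu : ∀ i w u, HasGradientAt (fun u' => Hi i w u') (Gu i w u) u)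
    (hLip : ∀ i w u w' u',
      ‖Gw i w u - Gw i w' u'‖ ^ 2 + ‖Gu i w u - Gu i w' u'‖ ^ 2 ≤
        Lw ^ 2 * ‖w - w'‖ ^ 2 + Lu ^ 2 * ‖u - u'‖ ^ 2)
    -- component-variance bound in `w`
    (Θw σw : ℝ) (hΘw : 0 ≤ Θw) (hσw : 0 ≤ σw)
    (hvarw : ∀ w u, (n : ℝ)⁻¹ * ∑ i, ‖Gw i w u - (n : ℝ)⁻¹ • ∑ j, Gw j w u‖ ^ 2 ≤
        Θw * ‖(n : ℝ)⁻¹ • ∑ j, Gw j w u‖ ^ 2 + σw ^ 2)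
    -- the maximizer `u₀*` (so `∇Φ₀(w) = ∇_w H(w, u₀*(w))`)
    (ustar : E → F)
    (hmax : ∀ w u, (n : ℝ)⁻¹ * ∑ i, Hi i w u - h u ≤
        (n : ℝ)⁻¹ * ∑ i, Hi i w (ustar w) - h (ustar w))
    -- the data of one shuffling descent epoch
    (wtil : E) (util : F) (πh : Equiv.Perm (Fin n))
    (η : ℝ) (hη : 0 < η) (hηc : 1 - 3 * Lw ^ 2 * η ^ 2 ≥ 0)
    (W : ℕ → E) (hW0 : W 0 = wtil)
    (hrec : ∀ i : Fin n, W ((i : ℕ) + 1) = W (i : ℕ) - (η / n) • Gw (πh i) (W (i : ℕ)) util)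
    (g : E) (hg : g = (n : ℝ)⁻¹ • ∑ j : Fin n, Gw (πh j) (W (j : ℕ)) util)
    (Δ : ℝ) (hΔ : Δ = (n : ℝ)⁻¹ * ∑ i : Fin n, ‖W (i : ℕ) - W 0‖ ^ 2) :
    -- (i)
    Δ ≤ 2 * (3 * Θw + 1) * η ^ 2 * ‖(n : ℝ)⁻¹ • ∑ j, Gw j wtil (ustar wtil)‖ ^ 2 +
        6 * η ^ 2 * σw ^ 2 + 4 * Lu ^ 2 * η ^ 2 * ‖util - ustar wtil‖ ^ 2 ∧
    -- (ii)
    ‖g - (n : ℝ)⁻¹ • ∑ j, Gw j wtil util‖ ^ 2 ≤ Lw ^ 2 * Δ ∧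
    -- (iii)
    ‖((n : ℝ)⁻¹ • ∑ j, Gw j wtil util) - ((n : ℝ)⁻¹ • ∑ j, Gw j wtil (ustar wtil))‖ ^ 2 ≤
      Lu ^ 2 * ‖util - ustar wtil‖ ^ 2 ∧
    -- (iv)
    ‖g - (n : ℝ)⁻¹ • ∑ j, Gw j wtil (ustar wtil)‖ ^ 2 ≤
      Lw ^ 2 * Δ + Lu ^ 2 * ‖util - ustar wtil‖ ^ 2 := by
  have hn' : (0 : ℝ) < n := by exact_mod_cast hn
  have hninv : (n : ℝ)⁻¹ * n = 1 := inv_mul_cancel₀ hn'.ne'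
  have hLw : ∀ i w u w' u', ‖Gw i w u - Gw i w' u'‖ ^ 2 ≤
      Lw ^ 2 * ‖w - w'‖ ^ 2 + Lu ^ 2 * ‖u - u'‖ ^ 2 := fun i w u w' u' => by
    have := hLip i w u w' u'
    have := sq_nonneg ‖Gu i w u - Gu i w' u'‖
    linarith
  have hperm : ∀ w u, ∑ j, Gw j w u = ∑ j, Gw (πh j) w u := fun w u =>
    (Equiv.sum_comp πh (fun j => Gw j w u)).symm
  have key : ∀ u', ∑ j : Fin n, ‖Gw (πh j) (W j) util - Gw (πh j) wtil u'‖ ^ 2 ≤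
      n * (Lw ^ 2 * Δ + Lu ^ 2 * ‖util - u'‖ ^ 2) := by
    intro u'
    have := Finset.sum_le_sum (s := Finset.univ)
      fun (j : Fin n) _ => hLw (πh j) (W j) util wtil u'
    refine this.trans (le_of_eq ?_)
    rw [Finset.sum_add_distrib, ← Finset.mul_sum, hΔ, hW0]
    simp only [Finset.sum_const, Finset.card_univ, Fintype.card_fin, nsmul_eq_mul]
    field_simp
  have hgen : ∀ u', ‖g - (n : ℝ)⁻¹ • ∑ j, Gw j wtil u'‖ ^ 2 ≤
      Lw ^ 2 * Δ + Lu ^ 2 * ‖util - u'‖ ^ 2 := by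
    intro u'
    rw [hg, hperm, ← smul_sub, ← Finset.sum_sub_distrib]
    refine (aux_mean n hn _).trans ?_
    calc _ ≤ (n : ℝ)⁻¹ * (n * (Lw ^ 2 * Δ + Lu ^ 2 * ‖util - u'‖ ^ 2)) := by
          gcongr; exact key u'
      _ = _ := by rw [← mul_assoc, hninv, one_mul]
  refine ⟨?_, ?_, ?_, hgen _⟩
  · set b := (n : ℝ)⁻¹ • ∑ j, Gw j wtil (ustar wtil) with hb
    set D := ‖util - ustar wtil‖ with hD
    have hv := hvarw wtil (ustar wtil)
    rw [← hb] at hv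
    let x : ℕ → E := fun k => if hk : k < n then
      Gw (πh ⟨k, hk⟩) (W k) util - Gw (πh ⟨k, hk⟩) wtil (ustar wtil) else 0
    let y : ℕ → E := fun k => if hk : k < n then
      Gw (πh ⟨k, hk⟩) wtil (ustar wtil) - b else 0
    have hd := aux_drift n hn W x y b η (Lw ^ 2 * Δ + Lu ^ 2 * D ^ 2)
      (Θw * ‖b‖ ^ 2 + σw ^ 2) ?_ ?_ ?_
    · rw [Finset.sum_range, ← hΔ] at hd
      have hΔ0 : 0 ≤ Δ := by rw [hΔ]; positivity
      have h1 : 0 ≤ (1 - 3 * Lw ^ 2 * η ^ 2) * Δ := mul_nonneg hηc hΔ0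
      have h2 : 0 ≤ η ^ 2 * (Lu ^ 2 * D ^ 2) := by positivity
      have h3 : 0 ≤ η ^ 2 * (Θw * ‖b‖ ^ 2) := by positivity
      have h4 : 0 ≤ η ^ 2 * σw ^ 2 := by positivity
      nlinarith
    · intro i hi
      have := hrec ⟨i, hi⟩
      simp only at this
      rw [this]
      simp only [x, y, hi, dif_pos]
      congr 2
      abel
    · rw [Finset.sum_range]
      simpa [x] using key (ustar wtil)
    · rw [Finset.sum_range]
      simp only [y, Fin.is_lt, dif_pos, Fin.eta]
      rw [Equiv.sum_comp πh (fun j => ‖Gw j wtil (ustar wtil) - b‖ ^ 2)]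
      rwa [inv_mul_le_iff₀ hn'] at hv
  · simpa using hgen util
  · rw [← smul_sub, ← Finset.sum_sub_distrib]
    refine (aux_mean n hn _).trans ?_
    rw [inv_mul_le_iff₀ hn']
    have := Finset.sum_le_sum (s := Finset.univ)
      fun (j : Fin n) _ => hLw j wtil util wtil (ustar wtil)
    simpa using this
end
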